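/- arXiv:1007.1717 — 7 statements merged into one kernel-verified Lean document; each statement's English description precedes it below -/
import Mathlib

section
/- If G is a connected triangle-free graph admitting an interval t-coloring for some t ≥ 1, then the greatest value W(G) of t for which G has an interval t-coloring satisfies W(G) ≤ |V(G)| − 1. -/
/-- An edge-coloring `c` of a graph `G` with colors `1, 2, ..., t` is an *interval
`t`-coloring* if every edge gets a color in `{1, ..., t}`, every color in `{1, ..., t}`
is used on some edge, the colors of edges incident to any vertex are distinct, and the
set of colors of edges incident to any vertex forms an interval of integers. -/
def IsIntervalColoring {V : Type*} (G : SimpleGraph V) (t : ℕ) (c : Sym2 V → ℕ) : Prop :=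
  (∀ e ∈ G.edgeSet, c e ∈ Finset.Icc 1 t) ∧
  (∀ i ∈ Finset.Icc 1 t, ∃ e ∈ G.edgeSet, c e = i) ∧
  (∀ v : V, ∀ e₁ ∈ G.edgeSet, ∀ e₂ ∈ G.edgeSet,
      v ∈ e₁ → v ∈ e₂ → c e₁ = c e₂ → e₁ = e₂) ∧
  (∀ v : V, ∃ a b : ℕ, {i : ℕ | ∃ e ∈ G.edgeSet, v ∈ e ∧ c e = i} = Set.Icc a b)

/-- `G` admits an interval `t`-coloring. -/
def HasIntervalColoring {V : Type*} (G : SimpleGraph V) (t : ℕ) : Prop :=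
  ∃ c : Sym2 V → ℕ, IsIntervalColoring G t c

/-- `f 0, f 1, ..., f (k + 1)` is a walk with at least two edges whose first edge has color `1`
and whose last edge has color `t`. -/
structure IsColorWalk {V : Type*} (G : SimpleGraph V) (t : ℕ) (c : Sym2 V → ℕ)
    (k : ℕ) (f : ℕ → V) : Prop where
  pos : 1 ≤ k
  adj : ∀ m ≤ k, G.Adj (f m) (f (m + 1))
  first : c s(f 0, f 1) = 1
  last : c s(f k, f (k + 1)) = t

/-- The colors of the edges of a walk, read as the digits of a number in base `t + 1`, the last
edge giving the leading digit. -/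
def walkWeight {V : Type*} (t : ℕ) (c : Sym2 V → ℕ) (k : ℕ) (f : ℕ → V) : ℕ :=
  ∑ m ∈ Finset.range (k + 1), c s(f m, f (m + 1)) * (t + 1) ^ m

section

variable {V : Type*} {G : SimpleGraph V} {t k : ℕ} {c : Sym2 V → ℕ} {f : ℕ → V}

namespace IsIntervalColoring

lemma color_mem (h : IsIntervalColoring G t c) {u v : V} (huv : G.Adj u v) :
    1 ≤ c s(u, v) ∧ c s(u, v) ≤ t := by
  simpa using h.1 s(u, v) huv

lemma exists_adj (h : IsIntervalColoring G t c) {i : ℕ} (h1 : 1 ≤ i) (ht : i ≤ t) :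
    ∃ u v, G.Adj u v ∧ c s(u, v) = i := by
  obtain ⟨e, he, hc⟩ := h.2.1 i (Finset.mem_Icc.2 ⟨h1, ht⟩)
  induction e with
  | _ u v => exact ⟨u, v, he, hc⟩

lemma eq_of_color_eq (h : IsIntervalColoring G t c) {v u w : V} (hu : G.Adj v u)
    (hw : G.Adj v w) (hc : c s(v, u) = c s(v, w)) : u = w := by
  exact Sym2.congr_right.1 (h.2.2.1 v s(v, u) hu s(v, w) hw (by simp) (by simp) hc)

lemma exists_color_eq (h : IsIntervalColoring G t c) {v u w : V} {i : ℕ} (hu : G.Adj v u)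
    (hw : G.Adj v w) (hui : c s(v, u) ≤ i) (hiw : i ≤ c s(v, w)) :
    ∃ x, G.Adj v x ∧ c s(v, x) = i := by
  obtain ⟨a, b, hab⟩ := h.2.2.2 v
  have hmem : ∀ x, G.Adj v x → c s(v, x) ∈ Set.Icc a b := fun x hx =>
    hab ▸ ⟨s(v, x), hx, by simp, rfl⟩
  have hi : i ∈ {i : ℕ | ∃ e ∈ G.edgeSet, v ∈ e ∧ c e = i} :=
    hab ▸ ⟨(hmem u hu).1.trans hui, hiw.trans (hmem w hw).2⟩
  obtain ⟨e, he, hve, hc⟩ := hi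
  obtain ⟨x, rfl⟩ := Sym2.mem_iff_exists.1 hve
  exact ⟨x, he, hc⟩

lemma exists_isColorWalk (h : IsIntervalColoring G t c) (hconn : G.Connected) (ht : 1 ≤ t) :
    ∃ k f, IsColorWalk G t c k f := by
  obtain ⟨a, b, hab, hc1⟩ := h.exists_adj le_rfl ht
  obtain ⟨x, y, hxy, hct⟩ := h.exists_adj ht le_rfl
  obtain ⟨p⟩ := hconn.preconnected b x
  let q := SimpleGraph.Walk.cons hab p
  have hq : q.length = p.length + 1 := by simp [q]
  refine ⟨p.length + 1, fun m => if m ≤ p.length + 1 then q.getVert m else y, ?_, ?_, ?_, ?_⟩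
  · simp
  · intro m hm
    rcases hm.eq_or_lt with rfl | hm
    · simpa [← hq] using hxy
    · simpa [hm.le, Nat.succ_le_of_lt hm] using q.adj_getVert_succ (hq ▸ hm)
  · simpa [q] using hc1
  · simpa [← hq] using hct

lemma walkWeight_le (h : IsIntervalColoring G t c) (hf : IsColorWalk G t c k f) :
    walkWeight t c k f ≤ ∑ m ∈ Finset.range (k + 1), t * (t + 1) ^ m :=
  Finset.sum_le_sum fun m hm => Nat.mul_le_mul_right _
    (h.color_mem (hf.adj m (Nat.le_of_lt_succ (Finset.mem_range.1 hm)))).2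

end IsIntervalColoring

namespace IsColorWalk

lemma shortcut_vertex (hf : IsColorWalk G t c k f) {j d : ℕ} {w : V} (hj : 1 ≤ j)
    (hd : j + 2 + d ≤ k) (h1 : G.Adj (f j) w) (h2 : G.Adj w (f (j + 2 + d))) :
    IsColorWalk G t c (k - d)
      (fun m => if m ≤ j then f m else if m = j + 1 then w else f (m + d)) where
  pos := by omega
  adj m hm := by
    rcases lt_trichotomy m j with h | rfl | h
    · simpa [h.le, Nat.succ_le_of_lt h] using hf.adj m (by omega)
    · simpa using h1
    · obtain rfl | h := (Nat.succ_le_of_lt h).eq_or_lt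
      · simpa using h2
      · have := hf.adj (m + d) (by omega)
        rw [if_neg (by omega), if_neg (by omega), if_neg (by omega), if_neg (by omega)]
        convert this using 2; omega
  first := by simpa [hj] using hf.first
  last := by
    have := hf.last
    rw [if_neg (by omega), if_neg (by omega), if_neg (by omega), if_neg (by omega)]
    rwa [show k - d + 1 + d = k + 1 by omega, Nat.sub_add_cancel (by omega)]

lemma shortcut_edge (hf : IsColorWalk G t c k f) {d : ℕ} (hd : 2 + d ≤ k)
    (h : G.Adj (f 1) (f (2 + d))) :
    IsColorWalk G t c (k - d) (fun m => if m ≤ 1 then f m else f (m + d)) where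
  pos := by omega
  adj m hm := by
    rcases lt_trichotomy m 1 with h' | rfl | h'
    · obtain rfl : m = 0 := by omega
      simpa using hf.adj 0 (by omega)
    · simpa using h
    · have := hf.adj (m + d) (by omega)
      rw [if_neg (by omega), if_neg (by omega)]
      convert this using 2; omega
  first := by simpa using hf.first
  last := by
    have := hf.last
    rw [if_neg (by omega), if_neg (by omega)]
    rwa [show k - d + 1 + d = k + 1 by omega, Nat.sub_add_cancel (by omega)]

lemma update (hf : IsColorWalk G t c k f) {j : ℕ} {w : V} (hj : 1 ≤ j) (hk : j + 2 ≤ k)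
    (h1 : G.Adj (f j) w) (h2 : G.Adj w (f (j + 2))) :
    IsColorWalk G t c k (Function.update f (j + 1) w) where
  pos := hf.pos
  adj m hm := by
    by_cases h : m = j
    · subst h; simpa using h1
    by_cases h' : m = j + 1
    · subst h'; simpa using h2
    · simpa [Function.update_of_ne, h, h'] using hf.adj m hm
  first := by
    rw [Function.update_of_ne (by omega), Function.update_of_ne (by omega)]
    exact hf.first
  last := by
    rw [Function.update_of_ne (by omega), Function.update_of_ne (by omega)]
    exact hf.last

end IsColorWalk

lemma walkWeight_lt_update {j : ℕ} {w : V} (hk : j + 2 ≤ k) (ht : c s(f j, f (j + 1)) ≤ t)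
    (hlt : c s(f (j + 1), f (j + 2)) < c s(w, f (j + 2))) :
    walkWeight t c k f < walkWeight t c k (Function.update f (j + 1) w) := by
  have hsub : {j, j + 1} ⊆ Finset.range (k + 1) := by
    intro x hx
    simp only [Finset.mem_insert, Finset.mem_singleton] at hx
    exact Finset.mem_range.2 (by omega)
  unfold walkWeight
  rw [← Finset.sum_sdiff hsub, ← Finset.sum_sdiff hsub]
  refine add_lt_add_of_le_of_lt (Finset.sum_le_sum fun m hm => ?_) ?_
  · simp only [Finset.mem_sdiff, Finset.mem_insert, Finset.mem_singleton, not_or] at hm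
    rw [Function.update_of_ne (by omega), Function.update_of_ne (by omega)]
  · rw [Finset.sum_pair (by omega), Finset.sum_pair (by omega)]
    simp only [Function.update_self, Function.update_of_ne (show j + 1 + 1 ≠ j + 1 by omega)]
    have hpow : 0 < (t + 1) ^ j := by positivity
    rw [pow_succ]
    have := Nat.mul_le_mul_right ((t + 1) ^ j) ht
    have := Nat.mul_le_mul_right ((t + 1) ^ j * (t + 1)) (Nat.succ_le_of_lt hlt)
    rw [show j + 1 + 1 = j + 2 from rfl]
    nlinarith [Nat.zero_le (c s(Function.update f (j + 1) w j, w) * (t + 1) ^ j)]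

/-- There is a shortest color walk, of greatest weight among the shortest ones. -/
lemma IsIntervalColoring.exists_extremal_isColorWalk (h : IsIntervalColoring G t c)
    (hconn : G.Connected) (ht : 1 ≤ t) :
    ∃ k f, IsColorWalk G t c k f ∧ (∀ k' g, IsColorWalk G t c k' g → k ≤ k') ∧
      ∀ g, IsColorWalk G t c k g → walkWeight t c k g ≤ walkWeight t c k f := by
  classical
  have hex := h.exists_isColorWalk hconn ht
  set k := Nat.find hex
  have hne : (walkWeight t c k '' {f | IsColorWalk G t c k f}).Nonempty :=
    Set.Nonempty.image _ (Nat.find_spec hex)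
  have hbdd : BddAbove (walkWeight t c k '' {f | IsColorWalk G t c k f}) :=
    ⟨_, Set.forall_mem_image.2 fun _ hf => h.walkWeight_le hf⟩
  obtain ⟨f, hf, hmax⟩ := Nat.sSup_mem hne hbdd
  exact ⟨k, f, hf, fun k' g hg => Nat.find_min' hex ⟨g, hg⟩,
    fun g hg => hmax ▸ le_csSup hbdd (Set.mem_image_of_mem _ hg)⟩

/-- For every color `i`, some inner vertex `f j` of the walk is incident to an edge of color `i`,
while all edges of the walk between `f 1` and `f j` have color less than `i`. -/
lemma IsColorWalk.exists_neighbor (hf : IsColorWalk G t c k f) (h : IsIntervalColoring G t c)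
    {i : ℕ} (h1 : 1 ≤ i) (ht : i ≤ t) :
    ∃ j w, 1 ≤ j ∧ j ≤ k ∧ (∀ m, 1 ≤ m → m < j → c s(f m, f (m + 1)) < i) ∧
      G.Adj (f j) w ∧ c s(f j, w) = i := by
  classical
  have hex : ∃ j, 1 ≤ j ∧ i ≤ c s(f j, f (j + 1)) := ⟨k, hf.pos, hf.last ▸ ht⟩
  obtain ⟨hj1, hij⟩ := Nat.find_spec hex
  have hjk : Nat.find hex ≤ k := Nat.find_min' hex ⟨hf.pos, hf.last ▸ ht⟩
  have hmin : ∀ m, 1 ≤ m → m < Nat.find hex → c s(f m, f (m + 1)) < i := fun m hm hmj =>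
    not_le.1 fun hi => Nat.find_min hex hmj ⟨hm, hi⟩
  generalize Nat.find hex = j at *
  obtain ⟨j, rfl⟩ : ∃ l, j = l + 1 := ⟨j - 1, by omega⟩
  have hprev : c s(f j, f (j + 1)) ≤ i := by
    rcases Nat.eq_zero_or_pos j with rfl | hj
    · simpa [hf.first] using h1
    · exact (hmin j hj (by omega)).le
  obtain ⟨w, hw, hc⟩ := h.exists_color_eq (hf.adj j (by omega)).symm (hf.adj _ hjk)
    (by rwa [Sym2.eq_swap]) hij
  exact ⟨j + 1, w, hj1, hjk, hmin, hw, hc⟩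

end

/-- If `G` is a connected triangle-free graph admitting an interval `t`-coloring for
some `t ≥ 1`, then `t ≤ |V(G)| - 1`; hence `W(G) ≤ |V(G)| - 1`. -/
theorem interval_coloring_triangle_free_bound {V : Type*} [Fintype V]
    (G : SimpleGraph V) (hconn : G.Connected) (hfree : G.CliqueFree 3)
    (t : ℕ) (ht : 1 ≤ t) (h : HasIntervalColoring G t) :
    t ≤ Fintype.card V - 1 := by
  classical
  obtain ⟨c, h⟩ := h
  obtain ⟨k, f, hf, hmin, hmax⟩ := h.exists_extremal_isColorWalk hconn ht
  have htri : ∀ a b w, G.Adj a b → G.Adj a w → G.Adj b w → False := fun a b w hab haw hbw =>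
    hfree {a, b, w} (SimpleGraph.is3Clique_triple_iff.2 ⟨hab, haw, hbw⟩)
  have := hconn.nonempty
  choose! j w hj1 hjk hfirst hadj hcol using
    fun i (hi : 1 ≤ i ∧ i ≤ t) => hf.exists_neighbor h hi.1 hi.2
  have hne : ∀ i, 1 ≤ i ∧ i ≤ t → ∀ i', 1 ≤ i' ∧ i' ≤ t → j i < j i' → w i ≠ w i' := by
    intro i hi i' hi' hlt hw
    have h1 := hadj i hi
    have h2 := hadj i' hi'
    have hj := hj1 i hi
    have hk := hjk i' hi'
    rw [← hw] at h2
    obtain ⟨d, hd⟩ := Nat.exists_eq_add_of_lt hlt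
    rcases d with _ | d
    · rw [hd] at h2
      exact htri _ _ _ (hf.adj (j i) (by omega)) h1 h2
    have hd' : j i' = j i + 2 + d := by omega
    have hs := hmin _ _ (hf.shortcut_vertex hj (hd' ▸ hk) h1 (hd' ▸ h2.symm))
    obtain rfl : d = 0 := by omega
    rw [add_zero] at hd'
    have hcol' := hcol i' hi'
    rw [← hw, hd'] at hcol'
    have hlt' := hfirst i' hi' (j i + 1) (by omega) (by omega)
    refine (hmax _ (hf.update hj (hd' ▸ hk) h1 (hd' ▸ h2.symm))).not_gt
      (walkWeight_lt_update (hd' ▸ hk) (h.color_mem (hf.adj _ (by omega))).2 ?_)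
    rwa [Sym2.eq_swap (a := w i), hcol']
  have hinj : Set.InjOn w (Finset.Icc 1 t) := by
    intro i hi i' hi' hw
    rw [Finset.coe_Icc] at hi hi'
    rcases lt_trichotomy (j i) (j i') with hlt | heq | hlt
    · exact (hne i hi i' hi' hlt hw).elim
    · rw [← hcol i hi, ← hcol i' hi', heq, hw]
    · exact (hne i' hi' i hi hlt hw.symm).elim
  have hnot : f 1 ∉ (Finset.Icc 1 t).image w := by
    simp only [Finset.mem_image, Finset.mem_Icc, not_exists, not_and]
    intro i hi hw
    have h1 := hadj i hi
    rw [hw] at h1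
    have hj := hj1 i hi
    have hk := hjk i hi
    have hj' : j i ≠ 1 := fun h' => G.irrefl (h' ▸ h1)
    obtain ⟨d, hd⟩ : ∃ d, j i = 2 + d := ⟨j i - 2, by omega⟩
    have hs := hmin _ _ (hf.shortcut_edge (hd ▸ hk) (hd ▸ h1.symm))
    obtain rfl : d = 0 := by omega
    have hlt := hfirst i hi 1 le_rfl (by omega)
    have hc := hcol i hi
    rw [hw, hd, Sym2.eq_swap] at hc
    exact hlt.ne hc
  have hcard := Finset.card_le_univ (insert (f 1) ((Finset.Icc 1 t).image w))
  rw [Finset.card_insert_of_notMem hnot, Finset.card_image_of_injOn hinj, Nat.card_Icc] at hcard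
  omega
end

section
/- If G is a connected bipartite graph admitting an interval t-coloring for some t ≥ 1, then the greatest value W(G) of t for which G has an interval t-coloring satisfies W(G) ≤ |V(G)| − 1. -/
/-- `G` is bipartite: the vertices can be split into a set `s` and its complement so
that every edge joins a vertex of `s` to a vertex outside `s`. -/
def IsBipartiteGraph {V : Type*} (G : SimpleGraph V) : Prop :=
  ∃ s : Set V, ∀ ⦃v w : V⦄, G.Adj v w → (v ∈ s ↔ w ∉ s)

/-- The edge-coloring `c` is proper on `G`, and the colors at each vertex have no gaps. -/
structure IsGaplessColoring {V : Type*} (G : SimpleGraph V) (c : Sym2 V → ℕ) : Prop where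
  proper : ∀ ⦃v w w' : V⦄, G.Adj v w → G.Adj v w' → c s(v, w) = c s(v, w') → w = w'
  gapless : ∀ ⦃v w w' : V⦄ ⦃k : ℕ⦄, G.Adj v w → G.Adj v w' → c s(v, w) ≤ k →
    k ≤ c s(v, w') → ∃ z, G.Adj v z ∧ c s(v, z) = k

/-- There is a walk starting with the dart `(u, v)`, with `n` further steps, along which the
colors strictly decrease down to `m`. -/
def HasDescent {V : Type*} (G : SimpleGraph V) (c : Sym2 V → ℕ) (m : ℕ) : ℕ → V → V → Prop
  | 0, u, v => G.Adj u v ∧ c s(u, v) = m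
  | n + 1, u, v => G.Adj u v ∧ ∃ w, G.Adj v w ∧ c s(v, w) < c s(u, v) ∧ HasDescent G c m n v w

/-- The colors of the edges in the connected component of `v`. -/
def componentColors {V : Type*} (G : SimpleGraph V) (c : Sym2 V → ℕ) (v : V) : Set ℕ :=
  {k | ∃ x y, G.Reachable v x ∧ G.Adj x y ∧ c s(x, y) = k}

section

variable {V : Type*} {G : SimpleGraph V} {c : Sym2 V → ℕ} {m : ℕ}

theorem HasDescent.adj {n : ℕ} {u v : V} (h : HasDescent G c m n u v) : G.Adj u v := by
  cases n <;> exact h.1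

theorem HasDescent.cons {n : ℕ} {u v w : V} (huv : G.Adj u v) (h : HasDescent G c m n v w)
    (hlt : c s(v, w) < c s(u, v)) : HasDescent G c m (n + 1) u v :=
  ⟨huv, w, h.adj, hlt, h⟩

/-- Along a shortest descent, the neighbors seen with intermediate colors are all distinct. -/
theorem exists_finset_of_shortest_descent [Finite V] (hc : IsGaplessColoring G c) (s : Set V)
    (hs : ∀ ⦃v w : V⦄, G.Adj v w → (v ∈ s ↔ w ∉ s)) (n : ℕ) :
    ∀ u v : V, HasDescent G c m n u v →
      (∀ k < n, ¬ HasDescent G c m k u v ∧ ¬ HasDescent G c m k v u) →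
      ∃ S : Finset V, u ∉ S ∧ v ∉ S ∧ c s(u, v) ≤ m + S.card ∧ (∀ w ∈ S, G.Reachable v w) ∧
        ∀ w ∈ S, ∃ y j, HasDescent G c m j w y ∧ c s(w, y) < c s(u, v) ∧ j ≤ n ∧
          ((w ∈ s ↔ v ∈ s) → j < n) := by
  classical
  have := Fintype.ofFinite V
  induction n with
  | zero =>
    intro u v h _
    exact ⟨∅, by simp, by simp, by simp [h.2], by simp, by simp⟩
  | succ n ih =>
    intro u v h hmin
    obtain ⟨huv, w₀, hw₀⟩ := h
    obtain ⟨v', hv', hmax⟩ := Finset.exists_max_image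
      (Finset.univ.filter fun w => G.Adj v w ∧ c s(v, w) < c s(u, v) ∧ HasDescent G c m n v w)
      (fun w => c s(v, w)) ⟨w₀, by simpa using hw₀⟩
    simp only [Finset.mem_filter, Finset.mem_univ, true_and] at hv' hmax
    obtain ⟨hvv', hlt, hd⟩ := hv'
    have hsw : ∀ a b : V, c s(a, b) = c s(b, a) := fun a b => by rw [Sym2.eq_swap]
    have hmin' : ∀ k < n, ¬ HasDescent G c m k v v' ∧ ¬ HasDescent G c m k v' v := by
      intro k hk
      refine ⟨fun h => (hmin (k + 1) (by omega)).1 (h.cons huv hlt), fun h => ?_⟩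
      cases k with
      | zero =>
        have h0 : HasDescent G c m 0 v v' := ⟨hvv', by rw [hsw]; exact h.2⟩
        exact (hmin 1 (by omega)).1 (h0.cons huv hlt)
      | succ k =>
        obtain ⟨_, y, _, hy, hdy⟩ := h
        rw [hsw v' v] at hy
        exact (hmin (k + 1) (by omega)).1 (hdy.cons huv (by omega))
    obtain ⟨S, hvS, hv'S, hcard, hreach, hS⟩ := ih v v' hd hmin'
    set N : Finset V := Finset.univ.filter fun w =>
      G.Adj v w ∧ c s(v, v') ≤ c s(v, w) ∧ c s(v, w) < c s(u, v) with hN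
    have memN : ∀ w, w ∈ N ↔ G.Adj v w ∧ c s(v, v') ≤ c s(v, w) ∧ c s(v, w) < c s(u, v) := by
      intro w; simp [hN]
    have hNcard : c s(u, v) ≤ c s(v, v') + N.card := by
      have hsub : Finset.Ico (c s(v, v')) (c s(u, v)) ⊆ N.image fun w => c s(v, w) := by
        intro k hk
        rw [Finset.mem_Ico] at hk
        obtain ⟨z, hz, rfl⟩ := hc.gapless hvv' huv.symm hk.1 (by rw [hsw v u]; omega)
        exact Finset.mem_image_of_mem _ ((memN z).2 ⟨hz, hk⟩)
      have := (Finset.card_le_card hsub).trans Finset.card_image_le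
      rw [Nat.card_Ico] at this
      omega
    have hdisj : Disjoint N S := by
      rw [Finset.disjoint_left]
      intro w hwN hwS
      obtain ⟨hvw, hle, hlt'⟩ := (memN w).1 hwN
      obtain ⟨y, j, hdj, hcy, -, hj⟩ := hS w hwS
      have hjn : j < n := hj (by have := hs hvw; have := hs hvv'; tauto)
      have hd' : HasDescent G c m (j + 1) v w := hdj.cons hvw (by omega)
      have hjn' : j + 1 = n := by
        by_contra hne
        exact (hmin (j + 2) (by omega)).1 (hd'.cons huv hlt')
      have := hmax w ⟨hvw, hlt', hjn' ▸ hd'⟩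
      exact hv'S (hc.proper hvw hvv' (by omega) ▸ hwS)
    refine ⟨N ∪ S, ?_, ?_, ?_, ?_, ?_⟩
    · rw [Finset.mem_union, not_or]
      refine ⟨fun hu => ?_, fun hu => ?_⟩
      · have := ((memN u).1 hu).2.2
        rw [hsw v u] at this
        omega
      · obtain ⟨y, j, hdj, hcy, -, hj⟩ := hS u hu
        have := hj (by have := hs huv; have := hs hvv'; tauto)
        exact (hmin (j + 1) (by omega)).2 (hdj.cons huv.symm (by rw [hsw v u]; omega))
    · rw [Finset.mem_union, not_or]
      exact ⟨fun hv => G.loopless.irrefl v ((memN v).1 hv).1, hvS⟩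
    · rw [Finset.card_union_of_disjoint hdisj]
      omega
    · intro w hw
      rcases Finset.mem_union.1 hw with hw | hw
      · exact ((memN w).1 hw).1.reachable
      · exact hvv'.reachable.trans (hreach w hw)
    · intro w hw
      rcases Finset.mem_union.1 hw with hw | hw
      · obtain ⟨hvw, hle, hlt'⟩ := (memN w).1 hw
        have hside : ¬ (w ∈ s ↔ v ∈ s) := by have := hs hvw; tauto
        by_cases hwv' : w = v'
        · subst hwv'
          cases n with
          | zero =>
            exact ⟨v, 0, ⟨hvw.symm, by rw [hsw]; exact hd.2⟩, by rw [hsw w v]; exact hlt,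
              by omega, fun h => absurd h hside⟩
          | succ n =>
            obtain ⟨_, y, _, hy, hdy⟩ := hd
            exact ⟨y, n, hdy, by omega, by omega, fun h => absurd h hside⟩
        · have hne : c s(v, v') ≠ c s(v, w) := fun h => hwv' (hc.proper hvv' hvw h).symm
          exact ⟨v, n + 1, hd.cons hvw.symm (by rw [hsw w v]; omega), by rw [hsw w v]; exact hlt',
            le_rfl, fun h => absurd h hside⟩
      · obtain ⟨y, j, hdj, hcy, hj, -⟩ := hS w hw
        exact ⟨y, j, hdj, by omega, by omega, fun _ => by omega⟩

/-- If all locally minimal edges in a component have color `m`, then there are descents. -/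
theorem exists_descent [Finite V] (v₀ : V)
    (hloc : ∀ x y, G.Reachable v₀ x → G.Adj x y → c s(x, y) ≠ m →
      (∀ z, G.Adj x z → c s(x, y) ≤ c s(x, z)) → ∃ z, G.Adj y z ∧ c s(y, z) < c s(x, y))
    (k : ℕ) : ∀ u v w, G.Reachable v₀ v → G.Adj u v → G.Adj v w → c s(v, w) < c s(u, v) →
      c s(u, v) = k → ∃ n, HasDescent G c m n u v := by
  induction k using Nat.strong_induction_on with
  | _ k ih =>
    rintro u v w hv huv hvw hlt rfl
    obtain ⟨x, hx, hxmin⟩ := Set.exists_min_image {x | G.Adj v x} (fun x => c s(v, x))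
      (Set.toFinite _) ⟨w, hvw⟩
    have hxlt : c s(v, x) < c s(u, v) := (hxmin w hvw).trans_lt hlt
    by_cases hm : c s(v, x) = m
    · exact ⟨1, huv, x, hx, hxlt, hx, hm⟩
    · obtain ⟨z, hz, hzlt⟩ := hloc v x hv hx hm hxmin
      obtain ⟨n, hn⟩ := ih _ hxlt v x z (hv.trans hx.reachable) hx hz hzlt rfl
      exact ⟨n + 1, hn.cons huv hxlt⟩

/-- A color range bound in a component whose locally minimal edges all have color `m`. -/
theorem color_add_two_le_of_forall_locally_minimal [Finite V] (hc : IsGaplessColoring G c)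
    (s : Set V) (hs : ∀ ⦃v w : V⦄, G.Adj v w → (v ∈ s ↔ w ∉ s)) (v₀ : V)
    (hloc : ∀ x y, G.Reachable v₀ x → G.Adj x y → c s(x, y) ≠ m →
      (∀ z, G.Adj x z → c s(x, y) ≤ c s(x, z)) → ∃ z, G.Adj y z ∧ c s(y, z) < c s(x, y))
    {u v : V} (hu : G.Reachable v₀ u) (huv : G.Adj u v) :
    c s(u, v) + 2 ≤ m + {w | G.Reachable v₀ w}.ncard := by
  classical
  have hsw : ∀ a b : V, c s(a, b) = c s(b, a) := fun a b => by rw [Sym2.eq_swap]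
  have hv : G.Reachable v₀ v := hu.trans huv.reachable
  have hex : ∃ n, HasDescent G c m n u v ∨ HasDescent G c m n v u := by
    by_cases hm : c s(u, v) = m
    · exact ⟨0, Or.inl ⟨huv, hm⟩⟩
    by_cases h : ∃ z, G.Adj u z ∧ c s(u, z) < c s(v, u)
    · obtain ⟨z, hz, hlt⟩ := h
      obtain ⟨n, hn⟩ := exists_descent v₀ hloc _ v u z hu huv.symm hz hlt rfl
      exact ⟨n, Or.inr hn⟩
    · push Not at h
      obtain ⟨z, hz, hlt⟩ := hloc u v hu huv hm (fun z hz => hsw u v ▸ h z hz)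
      obtain ⟨n, hn⟩ := exists_descent v₀ hloc _ u v z hv huv hz hlt rfl
      exact ⟨n, Or.inl hn⟩
  have key : ∀ a b, G.Reachable v₀ a → G.Adj a b → HasDescent G c m (Nat.find hex) a b →
      (∀ k < Nat.find hex, ¬ HasDescent G c m k a b ∧ ¬ HasDescent G c m k b a) →
      c s(a, b) + 2 ≤ m + {w | G.Reachable v₀ w}.ncard := by
    intro a b ha hab hd hmin
    obtain ⟨S, haS, hbS, hcard, hreach, -⟩ :=
      exists_finset_of_shortest_descent hc s hs _ a b hd hmin
    have hb := ha.trans hab.reachable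
    have hsub : ((insert a (insert b S) : Finset V) : Set V) ⊆ {w | G.Reachable v₀ w} := by
      intro w hw
      simp only [Finset.coe_insert, Set.mem_insert_iff, Finset.mem_coe] at hw
      rcases hw with rfl | rfl | hw
      exacts [ha, hb, hb.trans (hreach w hw)]
    have := Set.ncard_le_ncard hsub (Set.toFinite _)
    rw [Set.ncard_coe_finset, Finset.card_insert_of_notMem (by simp [haS, hab.ne]),
      Finset.card_insert_of_notMem hbS] at this
    omega
  have hmin : ∀ k < Nat.find hex, ¬ HasDescent G c m k u v ∧ ¬ HasDescent G c m k v u :=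
    fun k hk => not_or.1 (Nat.find_min hex hk)
  rcases Nat.find_spec hex with h | h
  · exact key u v hu huv h hmin
  · rw [hsw]
    exact key v u hv huv.symm h fun k hk => (hmin k hk).symm

theorem componentColors_eq_of_reachable {v x : V} (h : G.Reachable v x) :
    componentColors G c v = componentColors G c x := by
  ext k
  exact ⟨fun ⟨a, b, ha, hb⟩ => ⟨a, b, h.symm.trans ha, hb⟩,
    fun ⟨a, b, ha, hb⟩ => ⟨a, b, h.trans ha, hb⟩⟩

theorem setOf_reachable_eq_of_reachable {v x : V} (h : G.Reachable v x) :
    {w | G.Reachable v w} = {w | G.Reachable x w} := by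
  ext w
  exact ⟨fun hw => h.symm.trans hw, fun hw => h.trans hw⟩

theorem reachable_deleteEdges_or {x y w : V} (h : G.Reachable x w) :
    (G.deleteEdges {s(x, y)}).Reachable x w ∨ (G.deleteEdges {s(x, y)}).Reachable y w := by
  rw [SimpleGraph.reachable_iff_reflTransGen] at h
  induction h with
  | refl => exact Or.inl (SimpleGraph.Reachable.refl _)
  | @tail a b _ hab ih =>
    by_cases he : s(a, b) = s(x, y)
    · rcases Sym2.eq_iff.1 he with ⟨-, rfl⟩ | ⟨-, rfl⟩
      · exact Or.inr (SimpleGraph.Reachable.refl _)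
      · exact Or.inl (SimpleGraph.Reachable.refl _)
    · have hab' : (G.deleteEdges {s(x, y)}).Adj a b := by
        rw [SimpleGraph.deleteEdges_adj]
        exact ⟨hab, he⟩
      exact ih.imp (fun h => h.trans hab'.reachable) (fun h => h.trans hab'.reachable)

theorem IsGaplessColoring.deleteEdges (hc : IsGaplessColoring G c) {x y : V}
    (hx : ∀ z, G.Adj x z → c s(x, y) ≤ c s(x, z))
    (hy : ∀ z, G.Adj y z → c s(x, y) ≤ c s(y, z)) :
    IsGaplessColoring (G.deleteEdges {s(x, y)}) c where
  proper v w w' hw hw' h := by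
    rw [SimpleGraph.deleteEdges_adj] at hw hw'
    exact hc.proper hw.1 hw'.1 h
  gapless v w w' k hw hw' hk hk' := by
    rw [SimpleGraph.deleteEdges_adj] at hw hw'
    obtain ⟨z, hz, rfl⟩ := hc.gapless hw.1 hw'.1 hk hk'
    refine ⟨z, ?_, rfl⟩
    rw [SimpleGraph.deleteEdges_adj]
    refine ⟨hz, fun he => hw.2 ?_⟩
    have he : s(v, z) = s(x, y) := he
    have hle : c s(x, y) ≤ c s(v, w) := by
      rcases Sym2.eq_iff.1 he with ⟨rfl, -⟩ | ⟨rfl, -⟩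
      exacts [hx w hw.1, hy w hw.1]
    have : w = z := hc.proper hw.1 hz (le_antisymm hk (he ▸ hle))
    rw [this]
    exact he

/-- The color of a locally minimal edge that is not a bridge reappears after its deletion,
unless that color is minimal. -/
theorem mem_componentColors_deleteEdges (hc : IsGaplessColoring G c) {x y : V}
    (hx : ∀ z, G.Adj x z → c s(x, y) ≤ c s(x, z))
    (hy : ∀ z, G.Adj y z → c s(x, y) ≤ c s(y, z))
    (hxy : (G.deleteEdges {s(x, y)}).Reachable x y)
    (hm : ∃ k ∈ componentColors G c x, k < c s(x, y)) :
    c s(x, y) ∈ componentColors (G.deleteEdges {s(x, y)}) c x := by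
  have hH := hc.deleteEdges hx hy
  set H := G.deleteEdges {s(x, y)} with hHdef
  have hHG : ∀ {a b}, H.Adj a b → G.Adj a b := fun h => (SimpleGraph.deleteEdges_adj.1 h).1
  by_contra hmem
  have hprop : ∀ w, H.Reachable x w → ∀ z, H.Adj w z → c s(x, y) < c s(w, z) := by
    intro w hw
    have hw' := (SimpleGraph.reachable_iff_reflTransGen _ _).1 hw
    clear hw
    induction hw' with
    | refl =>
      intro z hz
      exact lt_of_le_of_ne (hx z (hHG hz)) fun h =>
        hmem ⟨x, z, SimpleGraph.Reachable.refl _, hz, h.symm⟩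
    | @tail a b ha hab ih =>
      intro z hz
      by_contra hle
      have hlt := ih b hab
      rw [Sym2.eq_swap (a := a)] at hlt
      obtain ⟨q, hq, hqc⟩ := hH.gapless hz hab.symm (not_lt.1 hle) hlt.le
      have ha' := (SimpleGraph.reachable_iff_reflTransGen _ _).2 ha
      exact hmem ⟨b, q, ha'.trans hab.reachable, hq, hqc⟩
  obtain ⟨k, ⟨a, b, ha, hab, rfl⟩, hk⟩ := hm
  have ha' : H.Reachable x a := (reachable_deleteEdges_or ha).elim id hxy.trans
  have hab' : H.Adj a b := SimpleGraph.deleteEdges_adj.2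
    ⟨hab, fun h => hk.ne (congrArg c (Set.mem_singleton_iff.1 h))⟩
  exact absurd (hprop a ha' b hab') (by omega)

theorem ncard_componentColors_lt [Finite V] (s : Set V) (c : Sym2 V → ℕ) (n : ℕ) :
    ∀ G : SimpleGraph V, G.edgeSet.ncard = n → IsGaplessColoring G c →
      (∀ ⦃v w : V⦄, G.Adj v w → (v ∈ s ↔ w ∉ s)) → ∀ v : V,
      (componentColors G c v).ncard < {w | G.Reachable v w}.ncard := by
  induction n using Nat.strong_induction_on with
  | _ n ih =>
    rintro G rfl hc hs v
    have hpos : 0 < {w | G.Reachable v w}.ncard :=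
      (Set.ncard_pos (Set.toFinite _)).2 ⟨v, SimpleGraph.Reachable.refl _⟩
    have hfin : ∀ (H : SimpleGraph V) (a : V), (componentColors H c a).Finite := fun H a =>
      (Set.finite_range c).subset (by rintro _ ⟨x, y, -, -, rfl⟩; exact ⟨_, rfl⟩)
    rcases Set.eq_empty_or_nonempty (componentColors G c v) with hem | hne
    · rwa [hem, Set.ncard_empty]
    obtain ⟨m, hm, hmmin⟩ := Set.exists_min_image _ id (hfin G v) hne
    by_cases hloc : ∀ x y, G.Reachable v x → G.Adj x y → c s(x, y) ≠ m →
      (∀ z, G.Adj x z → c s(x, y) ≤ c s(x, z)) → ∃ z, G.Adj y z ∧ c s(y, z) < c s(x, y)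
    · obtain ⟨t, ⟨a, b, ha, hab, rfl⟩, htmax⟩ := Set.exists_max_image _ id (hfin G v) hne
      have hbound := color_add_two_le_of_forall_locally_minimal hc s hs v hloc ha hab
      have hsub : componentColors G c v ⊆ Set.Icc m (c s(a, b)) :=
        fun k hk => ⟨hmmin k hk, htmax k hk⟩
      have hcard := Set.ncard_le_ncard hsub (Set.toFinite _)
      rw [← Finset.coe_Icc, Set.ncard_coe_finset, Nat.card_Icc] at hcard
      have := hmmin _ ⟨a, b, ha, hab, rfl⟩
      simp only [id] at this
      omega
    · push Not at hloc
      obtain ⟨x, y, hvx, hxy, hcm, hx, hy⟩ := hloc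
      rw [componentColors_eq_of_reachable hvx] at hm hmmin ⊢
      rw [setOf_reachable_eq_of_reachable hvx]
      have hH := hc.deleteEdges hx hy
      have hmem := mem_componentColors_deleteEdges hc hx hy
      have hor : ∀ w, G.Reachable x w → _ := fun w => reachable_deleteEdges_or (y := y)
      have hle : G.deleteEdges {s(x, y)} ≤ G := SimpleGraph.deleteEdges_le _
      have hcard : (G.deleteEdges {s(x, y)}).edgeSet.ncard < G.edgeSet.ncard := by
        refine Set.ncard_lt_ncard ?_ (Set.toFinite _)
        rw [SimpleGraph.edgeSet_deleteEdges]
        exact Set.sdiff_singleton_ssubset.2 hxy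
      have hadj : ∀ a b, G.Adj a b →
          (G.deleteEdges {s(x, y)}).Adj a b ∨ c s(a, b) = c s(x, y) := by
        intro a b hab
        by_cases he : s(a, b) = s(x, y)
        · exact Or.inr (congrArg c he)
        · exact Or.inl (SimpleGraph.deleteEdges_adj.2 ⟨hab, he⟩)
      set H := G.deleteEdges {s(x, y)}
      have hlt := ih _ hcard H rfl hH fun a b hab => hs (hle hab)
      by_cases hr : H.Reachable x y
      · have hcol := hmem hr ⟨m, hm, lt_of_le_of_ne
          (hmmin _ ⟨x, y, SimpleGraph.Reachable.refl _, hxy, rfl⟩) hcm.symm⟩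
        have hsub : componentColors G c x ⊆ componentColors H c x := by
          rintro k ⟨a, b, ha, hab, rfl⟩
          rcases hadj a b hab with h | h
          · exact ⟨a, b, (hor a ha).elim id hr.trans, h, rfl⟩
          · rwa [h]
        have hsub' : {w | H.Reachable x w} ⊆ {w | G.Reachable x w} := fun w hw => hw.mono hle
        have h₁ := Set.ncard_le_ncard hsub (hfin H x)
        have h₂ := Set.ncard_le_ncard hsub' (Set.toFinite _)
        have h₃ := hlt x
        omega
      · have hsub : componentColors G c x ⊆
            insert (c s(x, y)) (componentColors H c x ∪ componentColors H c y) := by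
          rintro k ⟨a, b, ha, hab, rfl⟩
          rcases hadj a b hab with h | h
          · exact Or.inr ((hor a ha).imp (fun ha => ⟨a, b, ha, h, rfl⟩)
              (fun ha => ⟨a, b, ha, h, rfl⟩))
          · exact Or.inl h
        have hsub' : {w | H.Reachable x w} ∪ {w | H.Reachable y w} ⊆ {w | G.Reachable x w} := by
          rintro w (hw | hw)
          · exact hw.mono hle
          · exact hxy.reachable.trans (hw.mono hle)
        have hdisj : Disjoint {w | H.Reachable x w} {w | H.Reachable y w} :=
          Set.disjoint_left.2 fun w h₁ h₂ =>
            hr (SimpleGraph.Reachable.trans h₁ (SimpleGraph.Reachable.symm h₂))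
        have h₁ := Set.ncard_le_ncard hsub (((hfin H x).union (hfin H y)).insert _)
        have h₂ := Set.ncard_le_ncard hsub' (Set.toFinite _)
        rw [Set.ncard_union_eq hdisj (Set.toFinite _) (Set.toFinite _)] at h₂
        have h₃ := Set.ncard_insert_le (c s(x, y)) (componentColors H c x ∪ componentColors H c y)
        have h₄ := Set.ncard_union_le (componentColors H c x) (componentColors H c y)
        have h₅ := hlt x
        have h₆ := hlt y
        omega

theorem IsIntervalColoring.isGaplessColoring {t : ℕ} (h : IsIntervalColoring G t c) :
    IsGaplessColoring G c where
  proper v w w' hw hw' heq := by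
    have := h.2.2.1 v s(v, w) hw s(v, w') hw' (Sym2.mem_mk_left _ _) (Sym2.mem_mk_left _ _) heq
    exact Sym2.congr_right.1 this
  gapless v w w' k hw hw' hk hk' := by
    obtain ⟨a, b, hab⟩ := h.2.2.2 v
    have h₁ : c s(v, w) ∈ Set.Icc a b := hab ▸ ⟨s(v, w), hw, Sym2.mem_mk_left _ _, rfl⟩
    have h₂ : c s(v, w') ∈ Set.Icc a b := hab ▸ ⟨s(v, w'), hw', Sym2.mem_mk_left _ _, rfl⟩
    have h₃ : k ∈ Set.Icc a b := ⟨h₁.1.trans hk, hk'.trans h₂.2⟩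
    rw [← hab] at h₃
    obtain ⟨e, he, hve, rfl⟩ := h₃
    obtain ⟨z, rfl⟩ := Sym2.mem_iff_exists.1 hve
    exact ⟨z, he, rfl⟩

end

/-- If `G` is a connected bipartite graph admitting an interval `t`-coloring for some
`t ≥ 1`, then `t ≤ |V(G)| - 1`; hence `W(G) ≤ |V(G)| - 1`. -/
theorem interval_coloring_bipartite_bound {V : Type*} [Fintype V]
    (G : SimpleGraph V) (hconn : G.Connected) (hbip : IsBipartiteGraph G)
    (t : ℕ) (ht : 1 ≤ t) (h : HasIntervalColoring G t) :
    t ≤ Fintype.card V - 1 := by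
  obtain ⟨c, hc⟩ := h
  obtain ⟨s, hs⟩ := hbip
  obtain ⟨v⟩ := hconn.nonempty
  have hlt := ncard_componentColors_lt s c _ G rfl hc.isGaplessColoring hs v
  have huniv : {w | G.Reachable v w} = Set.univ := Set.eq_univ_of_forall fun w => hconn v w
  rw [huniv, Set.ncard_univ, Nat.card_eq_fintype_card] at hlt
  have hsub : ((Finset.Icc 1 t : Finset ℕ) : Set ℕ) ⊆ componentColors G c v := by
    intro i hi
    obtain ⟨e, he, rfl⟩ := hc.2.1 i hi
    induction e using Sym2.ind with
    | _ x y => exact ⟨x, y, hconn v x, he, rfl⟩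
  have hfin : (componentColors G c v).Finite :=
    (Set.finite_range c).subset (by rintro _ ⟨x, y, -, -, rfl⟩; exact ⟨_, rfl⟩)
  have hle := Set.ncard_le_ncard hsub hfin
  rw [Set.ncard_coe_finset, Nat.card_Icc] at hle
  omega
end

section
/- If G is a connected (a,b)-biregular bipartite graph with |V(G)| ≥ 2(a+b) admitting an interval t-coloring for some t ≥ 1, then the greatest value W(G) of t for which G has an interval t-coloring satisfies W(G) ≤ |V(G)| − 3. -/
open SimpleGraph

namespace IsIntervalColoring

variable {V : Type*} {G : SimpleGraph V} {t : ℕ} {c : Sym2 V → ℕ}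

lemma exists_adj_color (hc : IsIntervalColoring G t c) {u x y : V} (hx : G.Adj u x)
    (hy : G.Adj u y) {j : ℕ} (h₁ : c s(u, x) ≤ j) (h₂ : j ≤ c s(u, y)) :
    ∃ z, G.Adj u z ∧ c s(u, z) = j := by
  obtain ⟨p, q, hpq⟩ := hc.2.2.2 u
  have hx' : c s(u, x) ∈ Set.Icc p q := hpq ▸ ⟨s(u, x), hx, by simp, rfl⟩
  have hy' : c s(u, y) ∈ Set.Icc p q := hpq ▸ ⟨s(u, y), hy, by simp, rfl⟩
  have hj : j ∈ Set.Icc p q := ⟨hx'.1.trans h₁, h₂.trans hy'.2⟩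
  rw [← hpq] at hj
  obtain ⟨e, he, hue, rfl⟩ := hj
  obtain ⟨z, rfl⟩ := Sym2.mem_iff_exists.mp hue
  exact ⟨z, he, rfl⟩

lemma color_add_one_le (hc : IsIntervalColoring G t c) {u x y : V} [Fintype (G.neighborSet u)]
    (hx : G.Adj u x) (hy : G.Adj u y) : c s(u, y) + 1 ≤ c s(u, x) + G.degree u := by
  have h : Finset.Icc (c s(u, x)) (c s(u, y)) ⊆
      (G.neighborFinset u).image fun z => c s(u, z) := by
    intro j hj
    rw [Finset.mem_Icc] at hj
    obtain ⟨z, hz, hzj⟩ := hc.exists_adj_color hx hy hj.1 hj.2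
    exact Finset.mem_image.mpr ⟨z, by simpa using hz, hzj⟩
  have h' := (Finset.card_le_card h).trans Finset.card_image_le
  rw [Nat.card_Icc, card_neighborFinset_eq_degree] at h'
  omega

lemma color_le (hc : IsIntervalColoring G t c) {u x : V} (hx : G.Adj u x) : c s(u, x) ≤ t :=
  (Finset.mem_Icc.mp (hc.1 _ (G.mem_edgeSet.mpr hx))).2

end IsIntervalColoring

/-- The first `k + 1` terms of `v` form a walk whose first edge has color `1` and whose last
edge has color `t`. -/
structure IsColorChain {V : Type*} (G : SimpleGraph V) (t : ℕ) (c : Sym2 V → ℕ) (k : ℕ)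
    (v : ℕ → V) : Prop where
  adj : ∀ i < k, G.Adj (v i) (v (i + 1))
  first : c s(v 0, v 1) = 1
  last : c s(v (k - 1), v k) = t

/-- The colors along a walk, read as the digits of a number in base `t + 1`. -/
def chainWeight {V : Type*} (t : ℕ) (c : Sym2 V → ℕ) (k : ℕ) (v : ℕ → V) : ℕ :=
  ∑ i ∈ Finset.range k, c s(v i, v (i + 1)) * (t + 1) ^ i

lemma chainWeight_lt_update {V : Type*} {t k i : ℕ} {c : Sym2 V → ℕ} {v : ℕ → V} {x : V}
    (hi : i + 1 < k) (hle : c s(v i, v (i + 1)) ≤ t)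
    (hlt : c s(v (i + 1), v (i + 2)) < c s(x, v (i + 2))) :
    chainWeight t c k v < chainWeight t c k (Function.update v (i + 1) x) := by
  have h₁ : i + 1 ∈ Finset.range k := Finset.mem_range.mpr hi
  have h₂ : i ∈ (Finset.range k).erase (i + 1) := by simp; omega
  unfold chainWeight
  rw [← Finset.add_sum_erase _ _ h₁, ← Finset.add_sum_erase _ _ h₂,
    ← Finset.add_sum_erase _ _ h₁, ← Finset.add_sum_erase _ _ h₂]
  have h₃ : ∀ m ∈ ((Finset.range k).erase (i + 1)).erase i,
      c s(v m, v (m + 1)) * (t + 1) ^ m =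
      c s(Function.update v (i + 1) x m, Function.update v (i + 1) x (m + 1)) * (t + 1) ^ m := by
    intro m hm
    simp only [Finset.mem_erase, Finset.mem_range] at hm
    rw [Function.update_of_ne (by omega), Function.update_of_ne (by omega)]
  rw [Finset.sum_congr rfl h₃]
  have h₄ : Function.update v (i + 1) x (i + 1 + 1) = v (i + 2) :=
    Function.update_of_ne (by omega) _ _
  rw [h₄, Function.update_self]
  have hpos : 0 < (t + 1) ^ i := by positivity
  have h₅ : c s(v i, v (i + 1)) * (t + 1) ^ i ≤ t * (t + 1) ^ i :=
    Nat.mul_le_mul_right _ hle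
  have h₆ : (c s(v (i + 1), v (i + 2)) + 1) * (t + 1) ^ (i + 1) ≤
      c s(x, v (i + 2)) * (t + 1) ^ (i + 1) := Nat.mul_le_mul_right _ hlt
  have h₇ : (t + 1) ^ (i + 1) = t * (t + 1) ^ i + (t + 1) ^ i := by ring
  rw [add_mul, one_mul] at h₆
  show c s(v (i + 1), v (i + 2)) * _ + _ < _
  omega

namespace IsColorChain

variable {V : Type*} {G : SimpleGraph V} {t k : ℕ} {c : Sym2 V → ℕ} {v : ℕ → V}

lemma update (hv : IsColorChain G t c k v) {i : ℕ} {x : V} (h₁ : 1 ≤ i) (h₂ : i + 2 < k)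
    (hx : G.Adj (v i) x) (hx' : G.Adj x (v (i + 2))) :
    IsColorChain G t c k (Function.update v (i + 1) x) := by
  refine ⟨fun m hm => ?_, ?_, ?_⟩
  · rcases eq_or_ne m (i + 1) with rfl | h
    · rw [Function.update_self, Function.update_of_ne (by omega)]
      exact hx'
    · rw [Function.update_of_ne h]
      rcases eq_or_ne m i with rfl | h'
      · rwa [Function.update_self]
      · rw [Function.update_of_ne (by omega)]
        exact hv.adj m hm
  · rw [Function.update_of_ne (by omega), Function.update_of_ne (by omega), hv.first]
  · rw [Function.update_of_ne (by omega), Function.update_of_ne (by omega), hv.last]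

lemma exists_max_weight (hc : IsIntervalColoring G t c) (hv : IsColorChain G t c k v) :
    ∃ w, IsColorChain G t c k w ∧
      ∀ w', IsColorChain G t c k w' → chainWeight t c k w' ≤ chainWeight t c k w := by
  let S : Set ℕ := {n | ∃ w, IsColorChain G t c k w ∧ chainWeight t c k w = n}
  have hS : BddAbove S := by
    refine ⟨∑ i ∈ Finset.range k, t * (t + 1) ^ i, ?_⟩
    rintro _ ⟨w, hw, rfl⟩
    exact Finset.sum_le_sum fun i hi =>
      Nat.mul_le_mul_right _ (hc.color_le (hw.adj i (Finset.mem_range.mp hi)))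
  obtain ⟨w, hw, hwS⟩ := Nat.sSup_mem (s := S) ⟨_, v, hv, rfl⟩ hS
  exact ⟨w, hw, fun w' hw' => hwS ▸ le_csSup hS ⟨w', hw', rfl⟩⟩

lemma dist_le (hconn : G.Connected) (hv : IsColorChain G t c k v) {i j : ℕ} (hij : i ≤ j)
    (hj : j ≤ k) : G.dist (v i) (v j) ≤ j - i := by
  induction j, hij using Nat.le_induction with
  | base => simp
  | succ j hij ih =>
    have h₁ := hconn.dist_triangle (u := v i) (v := v j) (w := v (j + 1))
    have h₂ := dist_eq_one_iff_adj.mpr (hv.adj j (by omega))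
    have h₃ := ih (by omega)
    omega

end IsColorChain

/-- A chain of least possible length exists. -/
lemma exists_isColorChain {V : Type*} {G : SimpleGraph V} {t : ℕ} {c : Sym2 V → ℕ}
    (hconn : G.Connected) (ht : 1 ≤ t) (hc : IsIntervalColoring G t c) :
    ∃ k v, 2 ≤ k ∧ IsColorChain G t c k v ∧ ∀ p q r s, G.Adj p q → c s(p, q) = 1 →
      G.Adj r s → c s(r, s) = t → k - 2 ≤ G.dist q r := by
  let S : Set ℕ := {n | ∃ p q r s, G.Adj p q ∧ c s(p, q) = 1 ∧ G.Adj r s ∧ c s(r, s) = t ∧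
    G.dist q r = n}
  have hS : S.Nonempty := by
    obtain ⟨e, he, he'⟩ := hc.2.1 1 (by simp [ht])
    obtain ⟨f, hf, hf'⟩ := hc.2.1 t (by simp [ht])
    induction e using Sym2.ind with | _ p q
    induction f using Sym2.ind with | _ r s
    exact ⟨_, p, q, r, s, he, he', hf, hf', rfl⟩
  obtain ⟨p, q, r, s, hpq, h₁, hrs, h₂, hd⟩ := Nat.sInf_mem hS
  obtain ⟨w, hw⟩ := (hconn q r).exists_walk_length_eq_dist
  refine ⟨w.length + 2, (Walk.cons hpq (w.concat hrs)).getVert, by omega,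
    ⟨fun i hi => ?_, ?_, ?_⟩, ?_⟩
  · exact Walk.adj_getVert_succ _ (by simp; omega)
  · simpa using h₁
  · have h₃ : (w.concat hrs).getVert w.length = r := by
      rw [Walk.concat_eq_append, Walk.getVert_append]; simp
    have h₄ : (w.concat hrs).getVert (w.length + 1) = s := by
      rw [Walk.concat_eq_append, Walk.getVert_append]; simp
    simpa [h₃, h₄] using h₂
  · intro p' q' r' s' a₁ a₂ a₃ a₄
    have : sInf S ≤ G.dist q' r' := Nat.sInf_le ⟨p', q', r', s', a₁, a₂, a₃, a₄, rfl⟩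
    omega

namespace IsColorChain

variable {V : Type*} {G : SimpleGraph V} {t k : ℕ} {c : Sym2 V → ℕ} {v : ℕ → V}

lemma exists_index (hc : IsIntervalColoring G t c) (hv : IsColorChain G t c k v) (hk : 1 ≤ k)
    {j : ℕ} (h₁ : 2 ≤ j) (h₂ : j ≤ t) :
    ∃ i x, 1 ≤ i ∧ i < k ∧ j ≤ c s(v i, v (i + 1)) ∧ (∀ m < i, c s(v m, v (m + 1)) < j) ∧
      G.Adj (v i) x ∧ c s(v i, x) = j := by
  have hlast : j ≤ c s(v (k - 1), v (k - 1 + 1)) := by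
    rw [Nat.sub_add_cancel hk, hv.last]; exact h₂
  have hex : ∃ i, j ≤ c s(v i, v (i + 1)) := ⟨_, hlast⟩
  classical
  obtain ⟨i, hi, hmin⟩ : ∃ i, j ≤ c s(v i, v (i + 1)) ∧ ∀ m < i, c s(v m, v (m + 1)) < j :=
    ⟨Nat.find hex, Nat.find_spec hex, fun m hm => not_le.mp (Nat.find_min hex hm)⟩
  have hik : i < k := by
    by_contra h
    exact absurd (hmin (k - 1) (by omega)) (not_lt.mpr hlast)
  obtain ⟨l, rfl⟩ : ∃ l, i = l + 1 := by
    refine Nat.exists_eq_succ_of_ne_zero ?_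
    rintro rfl
    have := hv.first
    simp only [zero_add] at hi
    omega
  obtain ⟨x, hx, hxj⟩ := hc.exists_adj_color (hv.adj l (by omega)).symm (hv.adj _ hik)
    (by rw [Sym2.eq_swap]; exact (hmin l (by omega)).le) hi
  exact ⟨l + 1, x, by omega, hik, hi, hmin, hx, hxj⟩

/-- In a chain of length at least `6` all vertices found by `exists_index` are distinct, and they
avoid the first two vertices of the chain and one further neighbor of each end. -/
lemma add_three_le_card [Fintype V] [DecidableEq V] [DecidableRel G.Adj] {s : Set V}
    (hbip : ∀ ⦃v w : V⦄, G.Adj v w → (v ∈ s ↔ w ∉ s))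
    (hdeg : ∀ ⦃v w : V⦄, (v ∈ s ↔ w ∈ s) → G.degree v = G.degree w)
    (hconn : G.Connected) (hc : IsIntervalColoring G t c) (hv : IsColorChain G t c k v)
    (hmin : ∀ p q r s, G.Adj p q → c s(p, q) = 1 → G.Adj r s → c s(r, s) = t →
      k - 2 ≤ G.dist q r)
    (hmax : ∀ w, IsColorChain G t c k w → chainWeight t c k w ≤ chainWeight t c k v)
    (ht : 1 ≤ t) (hk : 6 ≤ k) : t + 3 ≤ Fintype.card V := by
  have hadj_first : G.Adj (v 0) (v 1) := hv.adj 0 (by omega)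
  have hadj_last : G.Adj (v (k - 1)) (v k) := by
    have := hv.adj (k - 1) (by omega)
    rwa [Nat.sub_add_cancel (by omega)] at this
  have hfirst' : c s(v 1, v 0) = 1 := by rw [Sym2.eq_swap, hv.first]
  have hlast' : c s(v k, v (k - 1)) = t := by rw [Sym2.eq_swap, hv.last]
  have hd₁ := hmin _ _ _ _ hadj_first hv.first hadj_last hv.last
  have hd₂ := hmin _ _ _ _ hadj_first.symm hfirst' hadj_last hv.last
  have hd₃ := hmin _ _ _ _ hadj_first hv.first hadj_last.symm hlast'
  have hd₄ := hmin _ _ _ _ hadj_first.symm hfirst' hadj_last.symm hlast'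
  have hdist : ∀ i j, 1 ≤ i → i ≤ j → j < k → j ≤ i + G.dist (v i) (v j) := by
    intro i j h₁ h₂ h₃
    have e₁ := hv.dist_le hconn h₁ (by omega : i ≤ k)
    have e₂ := hv.dist_le hconn (by omega : j ≤ k - 1) (by omega)
    have e₃ := hconn.dist_triangle (u := v 1) (v := v i) (w := v (k - 1))
    have e₄ := hconn.dist_triangle (u := v i) (v := v j) (w := v (k - 1))
    omega
  have hdist_first : ∀ j, 1 ≤ j → j < k → j ≤ 1 + G.dist (v 0) (v j) := by
    intro j h₁ h₂
    have e₂ := hv.dist_le hconn (by omega : j ≤ k - 1) (by omega)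
    have e₄ := hconn.dist_triangle (u := v 0) (v := v j) (w := v (k - 1))
    omega
  have hdist_last : ∀ i, 1 ≤ i → i < k → k ≤ i + 1 + G.dist (v i) (v k) := by
    intro i h₁ h₂
    have e₁ := hv.dist_le hconn h₁ (by omega : i ≤ k)
    have e₃ := hconn.dist_triangle (u := v 1) (v := v i) (w := v k)
    omega
  have hdist_two : ∀ {p q x}, G.Adj p x → G.Adj q x → G.dist p q ≤ 2 := by
    intro p q x hp hq
    have e₁ := hconn.dist_triangle (u := p) (v := x) (w := q)
    have e₂ := dist_eq_one_iff_adj.mpr hp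
    have e₃ := dist_eq_one_iff_adj.mpr hq.symm
    omega
  have hside : ∀ {p q x}, G.Adj p x → G.Adj q x → (p ∈ s ↔ q ∈ s) := by
    intro p q x hp hq
    have := hbip hp
    have := hbip hq
    tauto
  have hstep : ∀ i < k, ¬ (v i ∈ s ↔ v (i + 1) ∈ s) := by
    intro i hi
    have := hbip (hv.adj i hi)
    tauto
  have hnbr : ∀ {p q r}, (p ∈ s ↔ q ∈ s) → G.Adj q r → ¬ G.Adj p r →
      ∃ x, G.Adj p x ∧ ¬ G.Adj q x := by
    intro p q r hpq hqr hpr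
    by_contra! h
    have hsub : G.neighborFinset p ⊆ G.neighborFinset q := fun x hx => by
      simpa using h x (by simpa using hx)
    have heq := Finset.eq_of_subset_of_card_le hsub
      (by simp only [card_neighborFinset_eq_degree]; exact (hdeg hpq).ge)
    have : r ∈ G.neighborFinset q := by simpa using hqr
    rw [← heq] at this
    exact hpr (by simpa using this)
  -- a neighbor of each end that is adjacent to no inner vertex of the chain
  obtain ⟨z, hz, hz₂⟩ : ∃ z, G.Adj (v 0) z ∧ ¬ G.Adj (v 2) z := by
    refine hnbr (r := v 3) (hside hadj_first (hv.adj 1 (by omega)).symm) (hv.adj 2 (by omega)) ?_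
    intro h
    have := dist_eq_one_iff_adj.mpr h
    have := hdist_first 3 (by omega) (by omega)
    omega
  obtain ⟨l, rfl⟩ : ∃ l, k = l + 3 := ⟨k - 3, by omega⟩
  obtain ⟨y, hy, hy₂⟩ : ∃ y, G.Adj (v (l + 3)) y ∧ ¬ G.Adj (v (l + 1)) y := by
    refine hnbr (r := v l) (hside hadj_last.symm (hv.adj (l + 1) (by omega)))
      (hv.adj l (by omega)).symm ?_
    intro h
    have := dist_eq_one_iff_adj.mpr h.symm
    have := hdist_last l (by omega) (by omega)
    omega
  have hz' : ∀ i, 1 ≤ i → i < l + 3 → ¬ G.Adj (v i) z := by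
    intro i h₁ h₂ h
    have e₁ := hdist_two hz h
    have e₂ := hdist_first i h₁ h₂
    have e₃ := hside hz h
    have s₀ := hstep 0 (by omega)
    have s₁ := hstep 1 (by omega)
    have s₂ := hstep 2 (by omega)
    obtain rfl | rfl | rfl : i = 1 ∨ i = 2 ∨ i = 3 := by omega
    · exact s₀ e₃
    · exact hz₂ h
    · simp only [zero_add, Nat.reduceAdd] at s₀ s₁ s₂
      tauto
  have hy' : ∀ i, 1 ≤ i → i < l + 3 → ¬ G.Adj (v i) y := by
    intro i h₁ h₂ h
    have e₁ := hdist_two h hy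
    have e₂ := hdist_last i h₁ h₂
    have e₃ := hside h hy
    have s₀ := hstep l (by omega)
    have s₁ := hstep (l + 1) (by omega)
    have s₂ := hstep (l + 2) (by omega)
    obtain rfl | rfl | rfl : i = l + 2 ∨ i = l + 1 ∨ i = l := by omega
    · exact s₂ e₃
    · exact hy₂ h
    · simp only [add_assoc, Nat.reduceAdd] at s₀ s₁ s₂
      tauto
  have : Nonempty V := ⟨v 0⟩
  choose! I f hI₁ hIk hIle hIlt hadj hcol using
    fun j (hj : 2 ≤ j ∧ j ≤ t) => hv.exists_index hc (by omega) hj.1 hj.2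
  have hne : ∀ j j', 2 ≤ j → j < j' → j' ≤ t → f j ≠ f j' := by
    intro j j' h₁ h₂ h₃ hf
    have J : 2 ≤ j ∧ j ≤ t := by omega
    have J' : 2 ≤ j' ∧ j' ≤ t := by omega
    have a := hadj j J
    have a' := hadj j' J'
    have b := hcol j J
    have b' := hcol j' J'
    have i₁ := hI₁ j J
    have i₂ := hIk j' J'
    have hle : I j ≤ I j' := by
      by_contra h
      have := hIlt j J (I j') (by omega)
      have := hIle j' J'
      omega
    rw [← hf] at a' b'
    have d₁ := hdist_two a a'
    have d₂ := hdist (I j) (I j') i₁ hle i₂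
    have d₃ := hside a a'
    have lt := hIlt j' J'
    generalize I j' = i' at *
    obtain rfl | rfl | rfl : i' = I j ∨ i' = I j + 1 ∨ i' = I j + 2 := by omega
    · omega
    · exact hstep _ (by omega) d₃
    · have := hmax _ (hv.update i₁ i₂ a a'.symm)
      have hlt := chainWeight_lt_update (t := t) (c := c) (v := v) (x := f j)
        (by omega : I j + 1 < l + 3) (hc.color_le (hv.adj _ (by omega)))
        (by rw [Sym2.eq_swap (a := f j), b']; exact lt _ (by omega))
      omega
  have hinj : Set.InjOn f ↑(Finset.Icc 2 t) := by
    intro j hj j' hj' h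
    simp only [Finset.coe_Icc, Set.mem_Icc] at hj hj'
    rcases lt_trichotomy j j' with hlt | heq | hlt
    · exact absurd h (hne j j' hj.1 hlt hj'.2)
    · exact heq
    · exact absurd h.symm (hne j' j hj'.1 hlt hj.2)
  have hf₀ : ∀ j, 2 ≤ j ∧ j ≤ t → f j ≠ v 0 := by
    intro j hj h
    have a := hadj j hj
    have b := hcol j hj
    have i₁ := hI₁ j hj
    have i₂ := hIk j hj
    rw [h] at a b
    have e₁ := dist_eq_one_iff_adj.mpr a.symm
    have e₂ := hdist_first _ i₁ i₂
    have s₀ := hstep 0 (by omega)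
    have s₁ := hstep 1 (by omega)
    have e₃ := hbip a
    generalize I j = i at *
    obtain rfl | rfl : i = 1 ∨ i = 2 := by omega
    · omega
    · simp only [zero_add, Nat.reduceAdd] at s₀ s₁
      tauto
  have hf₁ : ∀ j, 2 ≤ j ∧ j ≤ t → f j ≠ v 1 := by
    intro j hj h
    have a := hadj j hj
    have b := hcol j hj
    have i₁ := hI₁ j hj
    have i₂ := hIk j hj
    have lt := hIlt j hj
    rw [h] at a b
    have e₁ := dist_eq_one_iff_adj.mpr a.symm
    have e₂ := hdist 1 _ le_rfl i₁ i₂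
    generalize I j = i at *
    obtain rfl | rfl : i = 1 ∨ i = 2 := by omega
    · exact G.irrefl a
    · have := lt 1 (by omega)
      rw [Sym2.eq_swap] at b
      simp only [Nat.reduceAdd] at this
      omega
  have hdisj : Disjoint ((Finset.Icc 2 t).image f) {v 0, v 1, y, z} := by
    rw [Finset.disjoint_left]
    intro x hx hx'
    obtain ⟨j, hj, rfl⟩ := Finset.mem_image.mp hx
    rw [Finset.mem_Icc] at hj
    simp only [Finset.mem_insert, Finset.mem_singleton] at hx'
    have a := hadj j hj
    rcases hx' with h | h | h | h
    · exact hf₀ j hj h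
    · exact hf₁ j hj h
    · exact hy' _ (hI₁ j hj) (hIk j hj) (h ▸ a)
    · exact hz' _ (hI₁ j hj) (hIk j hj) (h ▸ a)
  have hfour : ({v 0, v 1, y, z} : Finset V).card = 4 := by
    have n₁ : v 0 ≠ v 1 := hadj_first.ne
    have n₂ : v 0 ≠ y := by
      rintro rfl
      have := dist_eq_one_iff_adj.mpr hy.symm
      omega
    have n₃ : v 0 ≠ z := hz.ne
    have n₄ : v 1 ≠ y := by
      rintro rfl
      have := dist_eq_one_iff_adj.mpr hy.symm
      omega
    have n₅ : v 1 ≠ z := by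
      rintro rfl
      exact hz₂ (hv.adj 1 (by omega)).symm
    have n₆ : y ≠ z := by
      rintro rfl
      have := hdist_two hz hy
      omega
    simp [n₁, n₂, n₃, n₄, n₅, n₆]
  have hcard := Finset.card_le_univ ((Finset.Icc 2 t).image f ∪ {v 0, v 1, y, z})
  rw [Finset.card_union_of_disjoint hdisj, hfour, Finset.card_image_of_injOn hinj,
    Nat.card_Icc] at hcard
  omega

end IsColorChain

/-- If `G` is a connected `(a,b)`-biregular bipartite graph (all vertices of one part
have degree `a`, all vertices of the other part have degree `b`) with
`|V(G)| ≥ 2(a+b)`, admitting an interval `t`-coloring for some `t ≥ 1`, then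
`t ≤ |V(G)| - 3`; hence `W(G) ≤ |V(G)| - 3`. -/
theorem interval_coloring_biregular_bound {V : Type*} [Fintype V] [DecidableEq V]
    (G : SimpleGraph V) [DecidableRel G.Adj] (a b : ℕ) (hconn : G.Connected)
    (hbireg : ∃ s : Set V, (∀ ⦃v w : V⦄, G.Adj v w → (v ∈ s ↔ w ∉ s)) ∧
      (∀ v ∈ s, G.degree v = a) ∧ (∀ v ∉ s, G.degree v = b))
    (hcard : Fintype.card V ≥ 2 * (a + b))
    (t : ℕ) (ht : 1 ≤ t) (h : HasIntervalColoring G t) :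
    t ≤ Fintype.card V - 3 := by
  classical
  obtain ⟨c, hc⟩ := h
  obtain ⟨s, hbip, ha, hb⟩ := hbireg
  obtain ⟨k, v₀, hk, hv₀, hmin⟩ := exists_isColorChain hconn ht hc
  obtain ⟨v, hv, hmax⟩ := hv₀.exists_max_weight hc
  rcases le_or_gt 6 k with h6 | h6
  · have hdeg : ∀ ⦃v w : V⦄, (v ∈ s ↔ w ∈ s) → G.degree v = G.degree w := by
      intro v w h
      by_cases hv : v ∈ s
      · rw [ha v hv, ha w (h.mp hv)]
      · rw [hb v hv, hb w fun hw => hv (h.mpr hw)]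
    have := hv.add_three_le_card hbip hdeg hconn hc hmin hmax ht h6
    omega
  · have hsum : ∀ i < k, G.degree (v i) + G.degree (v (i + 1)) = a + b := by
      intro i hi
      have := hbip (hv.adj i hi)
      by_cases h : v i ∈ s
      · rw [ha _ h, hb _ (this.mp h)]
      · rw [hb _ h, ha _ (by tauto), add_comm]
    have hstep : ∀ i, i + 1 < k →
        c s(v (i + 1), v (i + 2)) + 1 ≤ c s(v i, v (i + 1)) + G.degree (v (i + 1)) := by
      intro i hi
      have := hc.color_add_one_le (hv.adj i (by omega)).symm (hv.adj (i + 1) hi)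
      rwa [Sym2.eq_swap (b := v i)] at this
    have hpos : ∀ i < k, 1 ≤ G.degree (v i) := fun i hi =>
      (G.degree_pos_iff_exists_adj _).mpr ⟨_, hv.adj i hi⟩
    have hfirst := hv.first
    have hlast := hv.last
    have s₁ := hsum 1 (by omega)
    have p₀ := hpos 0 (by omega)
    have p₁ := hpos 1 (by omega)
    have s₀ := hsum 0 (by omega)
    have c₀ := hstep 0 (by omega)
    simp only [zero_add, Nat.reduceAdd] at s₀ s₁ c₀
    obtain rfl | rfl | rfl | rfl : k = 2 ∨ k = 3 ∨ k = 4 ∨ k = 5 := by omega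
    · simp only [Nat.reduceSub] at hlast
      omega
    · have c₁ := hstep 1 (by omega)
      simp only [Nat.reduceSub, Nat.reduceAdd] at hlast c₁
      omega
    · have c₁ := hstep 1 (by omega)
      have c₂ := hstep 2 (by omega)
      have s₂ := hsum 2 (by omega)
      simp only [Nat.reduceSub, Nat.reduceAdd] at hlast c₁ c₂ s₂
      omega
    · have c₁ := hstep 1 (by omega)
      have c₂ := hstep 2 (by omega)
      have c₃ := hstep 3 (by omega)
      have s₃ := hsum 3 (by omega)
      simp only [Nat.reduceSub, Nat.reduceAdd] at hlast c₁ c₂ c₃ s₃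
      omega
end

section
/- If G is a connected graph admitting an interval t-coloring for some t ≥ 1, then the greatest value W(G) of t for which G has an interval t-coloring satisfies W(G) ≤ 2|V(G)| − 3. -/
namespace SimpleGraph

/-- The colors at a vertex fill every gap between two of them. -/
theorem exists_adj_color_eq {V : Type*} {G : SimpleGraph V} {c : Sym2 V → ℕ}
    (hint : ∀ v : V, ∃ a b : ℕ, {i : ℕ | ∃ e ∈ G.edgeSet, v ∈ e ∧ c e = i} = Set.Icc a b)
    {v p w : V} (hp : G.Adj v p) (hw : G.Adj v w) {i : ℕ}
    (hpi : c s(v, p) ≤ i) (hiw : i ≤ c s(v, w)) :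
    ∃ u, G.Adj v u ∧ c s(v, u) = i := by
  obtain ⟨a, b, hab⟩ := hint v
  have mem (u : V) (hu : G.Adj v u) : c s(v, u) ∈ Set.Icc a b :=
    hab ▸ ⟨s(v, u), hu, Sym2.mem_mk_left v u, rfl⟩
  have hi : i ∈ Set.Icc a b := ⟨(mem p hp).1.trans hpi, hiw.trans (mem w hw).2⟩
  rw [← hab] at hi
  obtain ⟨e, he, hve, hce⟩ := hi
  obtain ⟨u, rfl⟩ := Sym2.mem_iff_exists.1 hve
  exact ⟨u, he, hce⟩

/-- A finite set of colors, each realized at `v` by a neighbor in `T`, has at most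
`#T` elements. -/
theorem card_colors_le {V : Type*} (c : Sym2 V → ℕ) (v : V)
    (s : Finset ℕ) (T : Finset V) (h : ∀ i ∈ s, ∃ u ∈ T, c s(v, u) = i) :
    s.card ≤ T.card := by
  classical
  calc s.card ≤ (T.image fun u => c s(v, u)).card :=
        Finset.card_le_card fun i hi => by simpa using h i hi
    _ ≤ T.card := Finset.card_image_le

/-- In a connected graph, a vertex distinct from `z` has a neighbor closer to `z`. -/
theorem Connected.exists_adj_dist_succ_eq {V : Type*} {G : SimpleGraph V}
    (hconn : G.Connected) {v z : V} (h : v ≠ z) :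
    ∃ w, G.Adj v w ∧ G.dist w z + 1 = G.dist v z := by
  obtain ⟨q, hq⟩ := hconn.exists_walk_length_eq_dist v z
  cases q with
  | nil => exact absurd rfl h
  | @cons _ w _ hvw q =>
    refine ⟨w, hvw, ?_⟩
    have h₁ := dist_le q
    have h₂ : G.dist v z ≤ G.dist v w + G.dist w z := hconn.dist_triangle
    have h₃ : G.dist v w = 1 := dist_eq_one_iff_adj.2 hvw
    rw [Walk.length_cons] at hq
    omega

/-- If `D` behaves like the distance to the set of its zeros, every zero of `D` meets an edge
of color `t`, and `D` has at least two zeros, then the colors above `C` are bounded by the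
sizes of the balls of radii `D v` and `D v + 1`, for any `v` with an edge of color at most `C`
that does not decrease `D`. -/
theorem color_add_le_card_balls {V : Type*} [Fintype V] {G : SimpleGraph V} {c : Sym2 V → ℕ}
    (hint : ∀ v : V, ∃ a b : ℕ, {i : ℕ | ∃ e ∈ G.edgeSet, v ∈ e ∧ c e = i} = Set.Icc a b)
    {t : ℕ} {D : V → ℕ} (hadj : ∀ u v, G.Adj u v → D u ≤ D v + 1)
    (hdesc : ∀ v, D v ≠ 0 → ∃ w, G.Adj v w ∧ D w + 1 = D v)
    (hzero : ∀ v, D v = 0 → ∃ w, G.Adj v w ∧ c s(v, w) = t)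
    (htwo : 2 ≤ (Finset.univ.filter fun u => D u ≤ 0).card)
    (d : ℕ) (v p : V) (C : ℕ) (hv : D v = d) (hp : G.Adj v p) (hpd : d ≤ D p)
    (hpC : c s(v, p) ≤ C) :
    t + d + 4 ≤ C + (Finset.univ.filter fun u => D u ≤ d).card
      + (Finset.univ.filter fun u => D u ≤ d + 1).card := by
  classical
  have card_pair : ({v, p} : Finset V).card = 2 := Finset.card_pair hp.ne
  induction d generalizing v p C with
  | zero =>
    obtain ⟨w, hw, hwt⟩ := hzero v hv
    have hsub : ({v, p} : Finset V) ⊆ Finset.univ.filter fun u => D u ≤ 0 + 1 := by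
      intro u hu
      have := hadj p v hp.symm
      simp only [Finset.mem_insert, Finset.mem_singleton] at hu
      rcases hu with rfl | rfl <;> simp <;> omega
    have key := card_colors_le c v (Finset.Ioc C t)
      ((Finset.univ.filter fun u => D u ≤ 0 + 1) \ {v, p}) (by
        intro i hi
        rw [Finset.mem_Ioc] at hi
        obtain ⟨u, hu, hui⟩ := exists_adj_color_eq hint hp hw (i := i) (by omega) (by omega)
        have h₁ := hadj u v hu.symm
        have h₂ : u ≠ p := by rintro rfl; omega
        refine ⟨u, ?_, hui⟩
        simp only [Finset.mem_sdiff, Finset.mem_filter, Finset.mem_univ, true_and,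
          Finset.mem_insert, Finset.mem_singleton, not_or]
        exact ⟨by omega, hu.ne', h₂⟩)
    rw [Finset.card_sdiff_of_subset hsub, Nat.card_Ioc, card_pair] at key
    have := Finset.card_le_card hsub
    omega
  | succ d ih =>
    obtain ⟨w, hw, hmin⟩ : ∃ w, (G.Adj v w ∧ D w = d) ∧
        ∀ u, G.Adj v u → D u = d → c s(v, w) ≤ c s(v, u) := by
      obtain ⟨w₀, hw₀, hd₀⟩ := hdesc v (by omega)
      obtain ⟨w, hw, hmin⟩ := Finset.exists_min_image
        (Finset.univ.filter fun u => G.Adj v u ∧ D u = d) (fun u => c s(v, u))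
        ⟨w₀, by simp only [Finset.mem_filter, Finset.mem_univ, true_and]; exact ⟨hw₀, by omega⟩⟩
      simp only [Finset.mem_filter, Finset.mem_univ, true_and] at hw hmin
      exact ⟨w, hw, fun u h₁ h₂ => hmin u ⟨h₁, h₂⟩⟩
    obtain ⟨hvw, hwd⟩ := hw
    have step := ih w v (max C (c s(v, w))) hwd hvw.symm (by omega)
      (by rw [Sym2.eq_swap]; exact le_max_right _ _) (Finset.card_pair hvw.ne')
    have hball : (Finset.univ.filter fun u => D u ≤ d) ⊆
        Finset.univ.filter fun u => D u ≤ d + 1 + 1 :=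
      Finset.monotone_filter_right _ fun u _ hu => by omega
    have hsub : ({v, p} : Finset V) ⊆ (Finset.univ.filter fun u => D u ≤ d + 1 + 1) \
        Finset.univ.filter fun u => D u ≤ d := by
      intro u hu
      have := hadj p v hp.symm
      simp only [Finset.mem_insert, Finset.mem_singleton] at hu
      rcases hu with rfl | rfl <;> simp <;> omega
    have key := card_colors_le c v (Finset.Ioo C (c s(v, w)))
      (((Finset.univ.filter fun u => D u ≤ d + 1 + 1) \
        Finset.univ.filter fun u => D u ≤ d) \ {v, p}) (by
        intro i hi
        rw [Finset.mem_Ioo] at hi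
        obtain ⟨u, hu, hui⟩ := exists_adj_color_eq hint hp hvw (i := i) (by omega) (by omega)
        have h₁ := hadj u v hu.symm
        have h₂ : u ≠ p := by rintro rfl; omega
        have h₃ := hadj v u hu
        have h₄ : D u ≠ d := fun h => by have := hmin u hu h; omega
        refine ⟨u, ?_, hui⟩
        simp only [Finset.mem_sdiff, Finset.mem_filter, Finset.mem_univ, true_and,
          Finset.mem_insert, Finset.mem_singleton, not_or]
        exact ⟨⟨by omega, by omega⟩, hu.ne', h₂⟩)
    have hle := Finset.card_le_card hsub
    rw [Finset.card_sdiff_of_subset hsub, Nat.card_Ioo, card_pair] at key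
    rw [card_pair] at hle
    rw [Finset.card_sdiff_of_subset hball] at key hle
    omega

end SimpleGraph

/-- If `G` is a connected graph admitting an interval `t`-coloring for some `t ≥ 1`,
then `t ≤ 2|V(G)| - 3`; hence `W(G) ≤ 2|V(G)| - 3`. -/
theorem interval_coloring_bound {V : Type*} [Fintype V]
    (G : SimpleGraph V) (hconn : G.Connected)
    (t : ℕ) (ht : 1 ≤ t) (h : HasIntervalColoring G t) :
    t ≤ 2 * Fintype.card V - 3 := by
  obtain ⟨c, -, hsurj, -, hint⟩ := h
  obtain ⟨e₁, he₁, hc₁⟩ := hsurj 1 (by simpa using ht)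
  obtain ⟨e₂, he₂, hc₂⟩ := hsurj t (by simpa using ht)
  induction e₁ with | _ p q
  induction e₂ with | _ y z
  rw [SimpleGraph.mem_edgeSet] at he₁ he₂
  set D : V → ℕ := fun v => min (G.dist v y) (G.dist v z) with hD
  have dist_le (u v x : V) (huv : G.Adj u v) : G.dist u x ≤ G.dist v x + 1 := by
    have h₁ : G.dist u x ≤ G.dist u v + G.dist v x := hconn.dist_triangle
    have h₂ : G.dist u v = 1 := SimpleGraph.dist_eq_one_iff_adj.2 huv
    omega
  have hadj (u v : V) (huv : G.Adj u v) : D u ≤ D v + 1 := by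
    have := dist_le u v y huv
    have := dist_le u v z huv
    simp only [hD]
    omega
  have hdesc (v : V) (hv : D v ≠ 0) : ∃ w, G.Adj v w ∧ D w + 1 = D v := by
    have closer (x : V) (hx : D v = G.dist v x) (hle : ∀ u, D u ≤ G.dist u x) :
        ∃ w, G.Adj v w ∧ D w + 1 = D v := by
      have hvx : v ≠ x := by
        rintro rfl
        simp [hx] at hv
      obtain ⟨w, hw, hd⟩ := hconn.exists_adj_dist_succ_eq hvx
      have := hadj v w hw
      have := hle w
      exact ⟨w, hw, by omega⟩
    rcases le_total (G.dist v y) (G.dist v z) with h | h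
    · exact closer y (min_eq_left h) fun u => min_le_left _ _
    · exact closer z (min_eq_right h) fun u => min_le_right _ _
  have hzero (v : V) (hv : D v = 0) : ∃ w, G.Adj v w ∧ c s(v, w) = t := by
    have : G.dist v y = 0 ∨ G.dist v z = 0 := by
      simp only [hD] at hv
      omega
    rw [hconn.dist_eq_zero_iff, hconn.dist_eq_zero_iff] at this
    rcases this with rfl | rfl
    · exact ⟨z, he₂, hc₂⟩
    · exact ⟨y, he₂.symm, by rw [Sym2.eq_swap]; exact hc₂⟩
  have htwo : 2 ≤ (Finset.univ.filter fun u => D u ≤ 0).card := by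
    classical
    rw [← Finset.card_pair he₂.ne]
    refine Finset.card_le_card fun u hu => ?_
    simp only [Finset.mem_insert, Finset.mem_singleton] at hu
    rcases hu with rfl | rfl <;> simp [hD]
  have bound (v p : V) (hp : G.Adj v p) (hle : D v ≤ D p) (hc : c s(v, p) = 1) :
      t ≤ 2 * Fintype.card V - 3 := by
    have h₁ := SimpleGraph.color_add_le_card_balls hint hadj hdesc hzero htwo
      (D v) v p 1 rfl hp hle hc.le
    have h₂ := Finset.card_le_univ (Finset.univ.filter fun u => D u ≤ D v)
    have h₃ := Finset.card_le_univ (Finset.univ.filter fun u => D u ≤ D v + 1)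
    omega
  rcases le_total (D p) (D q) with hle | hle
  · exact bound p q he₁ hle hc₁
  · exact bound q p he₁.symm hle (by rw [Sym2.eq_swap]; exact hc₁)
end

section
/- If G is a connected graph with |V(G)| ≥ 3 admitting an interval t-coloring for some t ≥ 1, then the greatest value W(G) of t for which G has an interval t-coloring satisfies W(G) ≤ 2|V(G)| − 4. -/
/-- The color `i` appears on some edge of `G` incident to `v`. -/
def SeesColor {V : Type*} (G : SimpleGraph V) (c : Sym2 V → ℕ) (v : V) (i : ℕ) : Prop :=
  ∃ w, G.Adj v w ∧ c s(v, w) = i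

theorem seesColor_iff {V : Type*} {G : SimpleGraph V} {c : Sym2 V → ℕ} {v : V} {i : ℕ} :
    SeesColor G c v i ↔ ∃ e ∈ G.edgeSet, v ∈ e ∧ c e = i := by
  constructor
  · rintro ⟨w, hw, hc⟩
    exact ⟨s(v, w), hw, Sym2.mem_mk_left v w, hc⟩
  · rintro ⟨e, he, hv, hc⟩
    obtain ⟨w, rfl⟩ := Sym2.mem_iff_exists.1 hv
    exact ⟨w, he, hc⟩

namespace IsIntervalColoring

variable {V : Type*} {G : SimpleGraph V} {t : ℕ} {c : Sym2 V → ℕ}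

theorem seesColor_mem (h : IsIntervalColoring G t c) {v : V} {i : ℕ}
    (hi : SeesColor G c v i) : 1 ≤ i ∧ i ≤ t := by
  obtain ⟨w, hw, rfl⟩ := hi
  exact Finset.mem_Icc.1 (h.1 s(v, w) hw)

theorem exists_seesColor (h : IsIntervalColoring G t c) {i : ℕ} (h1 : 1 ≤ i) (ht : i ≤ t) :
    ∃ v, SeesColor G c v i := by
  obtain ⟨e, he, hc⟩ := h.2.1 i (Finset.mem_Icc.2 ⟨h1, ht⟩)
  induction e with
  | h v w => exact ⟨v, w, he, hc⟩

theorem seesColor_of_between (h : IsIntervalColoring G t c) {v : V} {i j k : ℕ}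
    (hi : SeesColor G c v i) (hk : SeesColor G c v k) (hij : i ≤ j) (hjk : j ≤ k) :
    SeesColor G c v j := by
  obtain ⟨a, b, hab⟩ := h.2.2.2 v
  have key : ∀ m, SeesColor G c v m ↔ m ∈ Set.Icc a b := by
    intro m
    rw [← hab, seesColor_iff]
    rfl
  rw [key] at *
  exact ⟨hi.1.trans hij, hjk.trans hk.2⟩

/-- The largest color that can be reached, through a single vertex, from colors at most `m`. -/
theorem exists_max_reach (h : IsIntervalColoring G t c) (m : ℕ) :
    ∃ f, (∀ x i j, i ≤ m → SeesColor G c x i → SeesColor G c x j → j ≤ f) ∧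
      (1 ≤ m → m ≤ t → ∃ v, SeesColor G c v m ∧ SeesColor G c v f) := by
  let S : Set ℕ := {j | ∃ x i, i ≤ m ∧ SeesColor G c x i ∧ SeesColor G c x j}
  have hb : BddAbove S := ⟨t, fun j ⟨x, i, _, _, hj⟩ => (h.seesColor_mem hj).2⟩
  have hmax : ∀ x i j, i ≤ m → SeesColor G c x i → SeesColor G c x j → j ≤ sSup S :=
    fun x i j him hi hj => le_csSup hb ⟨x, i, him, hi, hj⟩
  refine ⟨sSup S, hmax, fun h1 ht => ?_⟩
  obtain ⟨u, hu⟩ := h.exists_seesColor h1 ht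
  have hne : S.Nonempty := ⟨m, u, m, le_rfl, hu, hu⟩
  obtain ⟨x, i, him, hi, hj⟩ := Nat.sSup_mem hne hb
  exact ⟨x, h.seesColor_of_between hi hj him (hmax u m m le_rfl hu hu), hj⟩

/-- Cut `{1, ..., t}` greedily into consecutive blocks, each contained in the palette of a single
vertex `w j`, and let `q i` be the neighbor of `w (blk i)` along color `i`. -/
theorem exists_greedy_blocks (h : IsIntervalColoring G t c) (ht : 1 ≤ t) :
    ∃ (blk : ℕ → ℕ) (w q : ℕ → V),
      (∀ i, 1 ≤ i → i ≤ t → G.Adj (w (blk i)) (q i) ∧ c s(w (blk i), q i) = i) ∧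
      SeesColor G c (w (blk t)) t ∧
      blk 1 = 0 ∧
      (∀ i, i ≤ t → blk i ≤ blk t) ∧
      (∀ x i, SeesColor G c x 1 → SeesColor G c x i → blk i = 0) ∧
      (∀ x i j, SeesColor G c x i → SeesColor G c x j → blk j ≤ blk i + 1) := by
  choose F hF hFv using h.exists_max_reach
  obtain ⟨v₀, -⟩ := h.exists_seesColor le_rfl ht
  have hFle : ∀ m i, 1 ≤ i → i ≤ m → i ≤ t → i ≤ F m := by
    intro m i h1 hm hit
    obtain ⟨x, hx⟩ := h.exists_seesColor h1 hit
    exact hF m x i i hm hx hx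
  have hv : ∀ m, ∃ v, 1 ≤ m → m ≤ t → SeesColor G c v m ∧ SeesColor G c v (F m) := by
    intro m
    by_cases hm : 1 ≤ m ∧ m ≤ t
    · obtain ⟨v, hv⟩ := hFv m hm.1 hm.2
      exact ⟨v, fun _ _ => hv⟩
    · exact ⟨v₀, fun h1 h2 => absurd ⟨h1, h2⟩ hm⟩
  choose v hv using hv
  let b : ℕ → ℕ := fun j => Nat.rec 0 (fun _ s => F (s + 1)) j
  have hb : ∀ j, b (j + 1) = F (b j + 1) := fun _ => rfl
  have hbge : ∀ j, j ≤ t → j ≤ b j := by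
    intro j
    induction j with
    | zero => simp
    | succ j ih =>
      intro hj
      rw [hb]
      exact hFle _ _ (by omega) (by have := ih (by omega); omega) hj
  have hex : ∀ i, ∃ j, i ≤ t → i ≤ b (j + 1) := by
    intro i
    refine ⟨i - 1, fun hi => ?_⟩
    rcases Nat.eq_zero_or_pos i with rfl | h0
    · simp
    · rw [Nat.sub_add_cancel h0]
      exact hbge i hi
  classical
  let blk : ℕ → ℕ := fun i => Nat.find (hex i)
  have hblk : ∀ i, i ≤ t → i ≤ b (blk i + 1) := fun i => Nat.find_spec (hex i)
  have hblk_le : ∀ i j, i ≤ b (j + 1) → blk i ≤ j := fun i j hij =>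
    Nat.find_min' (hex i) fun _ => hij
  have hlt : ∀ i, 1 ≤ i → b (blk i) < i := by
    intro i h1
    rcases Nat.eq_zero_or_pos (blk i) with h0 | h0
    · rw [h0]
      exact h1
    · by_contra! hcon
      have := hblk_le i (blk i - 1) (by rwa [Nat.sub_add_cancel h0])
      omega
  have hpal : ∀ i, 1 ≤ i → i ≤ t → SeesColor G c (v (b (blk i) + 1)) i := by
    intro i h1 hit
    have h2 := hlt i h1
    obtain ⟨hl, hr⟩ := hv (b (blk i) + 1) (by omega) (by omega)
    exact h.seesColor_of_between hl hr (by omega) (hblk i hit)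
  have hq : ∀ i, ∃ y, 1 ≤ i → i ≤ t →
      G.Adj (v (b (blk i) + 1)) y ∧ c s(v (b (blk i) + 1), y) = i := by
    intro i
    by_cases hi : 1 ≤ i ∧ i ≤ t
    · obtain ⟨y, hy⟩ := hpal i hi.1 hi.2
      exact ⟨y, fun _ _ => hy⟩
    · exact ⟨v₀, fun h1 h2 => absurd ⟨h1, h2⟩ hi⟩
  choose q hq using hq
  refine ⟨blk, fun j => v (b j + 1), q, hq, hpal t ht le_rfl, ?_,
    fun i hi => hblk_le i _ (hi.trans (hblk t le_rfl)), ?_, ?_⟩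
  · exact Nat.le_zero.1 (hblk_le 1 0 (hFle _ _ le_rfl (by omega) ht))
  · intro x i h1 hi
    exact Nat.le_zero.1 (hblk_le i 0 (hF _ x 1 i (by omega) h1 hi))
  · intro x i j hi hj
    have := hblk i (h.seesColor_mem hi).2
    exact hblk_le j _ (hF (b (blk i + 1) + 1) x i j (by omega) hi hj)

end IsIntervalColoring

theorem Finset.card_le_two_of_forall_le_succ (s : Finset ℕ) (h : ∀ a ∈ s, ∀ b ∈ s, b ≤ a + 1) :
    s.card ≤ 2 := by
  rcases s.eq_empty_or_nonempty with rfl | hs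
  · simp
  · refine (Finset.card_le_card (t := {s.min' hs, s.min' hs + 1}) fun b hb => ?_).trans
      Finset.card_le_two
    have h1 := s.min'_le b hb
    have h2 := h _ (s.min'_mem hs) b hb
    simp only [Finset.mem_insert, Finset.mem_singleton]
    omega

/-- If `G` is a connected graph with `|V(G)| ≥ 3` admitting an interval `t`-coloring
for some `t ≥ 1`, then `t ≤ 2|V(G)| - 4`; hence `W(G) ≤ 2|V(G)| - 4`. -/
theorem interval_coloring_improved_bound {V : Type*} [Fintype V]
    (G : SimpleGraph V) (hconn : G.Connected) (hcard : Fintype.card V ≥ 3)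
    (t : ℕ) (ht : 1 ≤ t) (h : HasIntervalColoring G t) :
    t ≤ 2 * Fintype.card V - 4 := by
  classical
  obtain ⟨c, hc⟩ := h
  obtain ⟨blk, w, q, hq, hwt, hblk1, hblkt, hzero, hsucc⟩ := hc.exists_greedy_blocks ht
  set fib : V → Finset ℕ := fun x => (Finset.Icc 1 t).filter fun i => q i = x with hfib
  have hmem : ∀ x i, i ∈ fib x → G.Adj (w (blk i)) x ∧ c s(w (blk i), x) = i := by
    intro x i hi
    simp only [hfib, Finset.mem_filter, Finset.mem_Icc] at hi
    obtain ⟨⟨h1, h2⟩, rfl⟩ := hi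
    exact hq i h1 h2
  have hsees : ∀ x i, i ∈ fib x → SeesColor G c x i := fun x i hi =>
    ⟨w (blk i), (hmem x i hi).1.symm, by rw [Sym2.eq_swap]; exact (hmem x i hi).2⟩
  have hinj : ∀ x, Set.InjOn blk (fib x) := by
    intro x i hi j hj hij
    have h1 := (hmem x i hi).2
    rw [hij, (hmem x j hj).2] at h1
    exact h1.symm
  have htwo : ∀ x, (fib x).card ≤ 2 := by
    intro x
    rw [← Finset.card_image_of_injOn (hinj x)]
    apply Finset.card_le_two_of_forall_le_succ
    simp only [Finset.mem_image]
    rintro _ ⟨i, hi, rfl⟩ _ ⟨j, hj, rfl⟩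
    exact hsucc x i j (hsees x i hi) (hsees x j hj)
  have hone : ∀ x k, (∀ i ∈ fib x, blk i = k) → (fib x).card ≤ 1 := by
    intro x k hk
    rw [Finset.card_le_one]
    exact fun i hi j hj => hinj x hi hj ((hk i hi).trans (hk j hj).symm)
  have hsum : t = ∑ x, (fib x).card := by
    have := Finset.card_eq_sum_card_fiberwise (s := Finset.Icc 1 t) (t := Finset.univ) (f := q)
      (fun _ _ => Finset.mem_coe.2 (Finset.mem_univ _))
    simpa using this
  have h01 := hq 1 le_rfl ht
  rw [hblk1] at h01
  have hw1 : SeesColor G c (w 0) 1 := ⟨q 1, h01⟩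
  have hu1 : SeesColor G c (q 1) 1 := ⟨w 0, h01.1.symm, by rw [Sym2.eq_swap]; exact h01.2⟩
  have hw0 : (fib (w 0)).card = 0 := by
    rw [Finset.card_eq_zero, Finset.eq_empty_iff_forall_notMem]
    intro i hi
    have h1 := (hmem _ i hi).1
    rw [hzero _ i hw1 (hsees _ i hi)] at h1
    exact G.irrefl h1
  rcases Nat.eq_zero_or_pos (blk t) with hK | hK
  · have hall : ∀ x, ∀ i ∈ fib x, blk i = 0 := fun x i hi => by
      have := hblkt i (hc.seesColor_mem (hsees x i hi)).2
      omega
    have hle : ∑ x, ((fib x).card + if x = w 0 then 1 else 0) ≤ ∑ _x : V, 1 := by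
      refine Finset.sum_le_sum fun x _ => ?_
      have := hone x 0 (hall x)
      split_ifs with hx
      · subst hx
        omega
      · omega
    rw [Finset.sum_add_distrib, ← hsum] at hle
    simp at hle
    omega
  · have hne : ∀ x, SeesColor G c x 1 → x ≠ w (blk t) := by
      rintro x hx rfl
      have := hzero _ t hx hwt
      omega
    have hu := hone (q 1) 0 fun i hi => hzero _ i hu1 (hsees _ i hi)
    have hlast := hone (w (blk t)) (blk t - 1) fun i hi => by
      have h1 := hsucc _ _ _ (hsees _ i hi) hwt
      have h2 := hblkt i (hc.seesColor_mem (hsees _ i hi)).2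
      have h3 : blk i ≠ blk t := fun h3 => (hmem _ i hi).1.ne (by rw [h3])
      omega
    have hle : ∑ x, ((fib x).card + (if x = w 0 then 2 else 0) + (if x = q 1 then 1 else 0) +
        if x = w (blk t) then 1 else 0) ≤ ∑ _x : V, 2 := by
      refine Finset.sum_le_sum fun x _ => ?_
      have h2 := htwo x
      have n1 := hne _ hw1
      have n2 := hne _ hu1
      have n3 := h01.1.ne
      by_cases hx0 : x = w 0
      · subst hx0
        simp [hw0, n1, n3]
      by_cases hx1 : x = q 1
      · subst hx1
        simp only [if_neg hx0, if_neg n2, if_true]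
        omega
      by_cases hxt : x = w (blk t)
      · subst hxt
        simp only [if_neg hx0, if_neg hx1, if_true]
        omega
      simpa [hx0, hx1, hxt] using h2
    rw [Finset.sum_add_distrib, Finset.sum_add_distrib, Finset.sum_add_distrib, ← hsum] at hle
    simp at hle
    omega
end

section
/- If G is a connected planar graph admitting an interval t-coloring for some t ≥ 1, then the greatest value W(G) of t for which G has an interval t-coloring satisfies W(G) ≤ (11/6)·|V(G)|. -/
/-- `G` is planar: it has a drawing in the plane with vertices at distinct points and
edges drawn as simple arcs between the images of their endpoints, such that an arc
meets a vertex point only at its own endpoints and two arcs of distinct edges meet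
only in common endpoints (no crossings). -/
def IsPlanarGraph {V : Type*} (G : SimpleGraph V) : Prop :=
  ∃ (pos : V → ℝ × ℝ) (γ : ∀ u v : V, G.Adj u v → Path (pos u) (pos v)),
    Function.Injective pos ∧
    (∀ (u v : V) (h : G.Adj u v), Function.Injective (γ u v h)) ∧
    (∀ (u v : V) (h : G.Adj u v), Set.range (γ u v h) = Set.range (γ v u h.symm)) ∧
    (∀ (u v : V) (h : G.Adj u v) (w : V), pos w ∈ Set.range (γ u v h) → w = u ∨ w = v) ∧
    (∀ (u v u' v' : V) (h : G.Adj u v) (h' : G.Adj u' v'), s(u, v) ≠ s(u', v') →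
      Set.range (γ u v h) ∩ Set.range (γ u' v' h') ⊆
        ({pos u, pos v} : Set (ℝ × ℝ)) ∩ {pos u', pos v'})

open Complex in
/-- A nowhere vanishing continuous function on a real plane has a continuous logarithm. -/
theorem exists_continuous_log {f : ℝ × ℝ → ℂ} (hf : Continuous f) (h0 : ∀ x, f x ≠ 0) :
    ∃ g : ℝ × ℝ → ℂ, Continuous g ∧ ∀ x, exp (g x) = f x := by
  have := (convex_univ (𝕜 := ℝ) (E := ℝ × ℝ)).contractibleSpace Set.univ_nonempty
  have hs : IsSimplyConnected (Set.univ : Set (ℝ × ℝ)) := SimplyConnectedSpace.ofContractible _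
  obtain ⟨g, hg, he⟩ := exists_continuousOn_eqOn_exp_comp hs isOpen_univ hf.continuousOn
    (by simpa using h0)
  exact ⟨g, continuousOn_univ.mp hg, fun x => he (Set.mem_univ x)⟩

/-- Two continuous logarithms of the same function on the line have the same increments. -/
theorem log_increment_unique {g h : ℝ → ℂ} (hg : Continuous g) (hh : Continuous h)
    (e : ∀ x, Complex.exp (g x) = Complex.exp (h x)) : g 1 - g 0 = h 1 - h 0 := by
  have hperiod : ∀ x, ∃ n : ℤ, g x - h x = n * (2 * Real.pi * Complex.I) := fun x => by
    obtain ⟨n, hn⟩ := Complex.exp_eq_exp_iff_exists_int.mp (e x)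
    exact ⟨n, by rw [hn]; ring⟩
  choose n hn using hperiod
  have hne : (2 * Real.pi * Complex.I : ℂ) ≠ 0 := Complex.two_pi_I_ne_zero
  have hn' : ∀ x, ((n x : ℝ) : ℂ) = (g x - h x) / (2 * Real.pi * Complex.I) := fun x => by
    rw [hn x]; field_simp; simp
  have hc : Continuous n := by
    have h1 : Continuous fun x => ((n x : ℝ) : ℂ) := by
      simp_rw [hn']; fun_prop
    have h2 : Continuous fun x => (n x : ℝ) := by
      exact Complex.continuous_re.comp h1
    exact Int.isClosedEmbedding_coe_real.isEmbedding.continuous_iff.mpr h2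
  have h3 : n 1 = n 0 := PreconnectedSpace.constant inferInstance hc
  have h4 := hn 1
  rw [h3, ← hn 0] at h4
  linear_combination h4

open Classical in
/-- The increment over `[0, 1]` of a continuous logarithm of `f`. -/
noncomputable def logIncrement (f : ℝ → ℂ) : ℂ :=
  if h : ∃ g : ℝ → ℂ, Continuous g ∧ ∀ x, Complex.exp (g x) = f x then
    h.choose 1 - h.choose 0 else 0

theorem logIncrement_eq {f g : ℝ → ℂ} (hg : Continuous g) (e : ∀ x, Complex.exp (g x) = f x) :
    logIncrement f = g 1 - g 0 := by
  have h : ∃ g : ℝ → ℂ, Continuous g ∧ ∀ x, Complex.exp (g x) = f x := ⟨g, hg, e⟩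
  rw [logIncrement, dif_pos h]
  exact log_increment_unique h.choose_spec.1 hg fun x => by rw [h.choose_spec.2, e]

theorem logIncrement_neg {f g : ℝ → ℂ} (hg : Continuous g) (e : ∀ x, Complex.exp (g x) = - f x) :
    logIncrement f = g 1 - g 0 := by
  rw [logIncrement_eq (g := fun x => g x + Real.pi * Complex.I) (by fun_prop)]
  · ring
  · intro x; rw [Complex.exp_add, e, Complex.exp_pi_mul_I]; ring

/-- The increments of the logarithm of `q t - p s` around the boundary of a square cancel. -/
theorem logIncrement_square {p q : ℝ → ℂ} (hp : Continuous p) (hq : Continuous q)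
    (h : ∀ s t, p s ≠ q t) :
    logIncrement (fun t => q t - p 0) + logIncrement (fun s => p s - q 1) =
      logIncrement (fun s => p s - q 0) + logIncrement (fun t => q t - p 1) ∧
    Complex.exp (logIncrement (fun t => q t - p 0)) = (q 1 - p 0) / (q 0 - p 0) ∧
    Complex.exp (logIncrement (fun t => q t - p 1)) = (q 1 - p 1) / (q 0 - p 1) := by
  obtain ⟨F, hF, he⟩ := exists_continuous_log (f := fun x : ℝ × ℝ => q x.2 - p x.1)
    (by fun_prop) (fun x => sub_ne_zero.mpr (h x.1 x.2).symm)
  rw [logIncrement_eq (g := fun t => F (0, t)) (by fun_prop) (fun t => he (0, t)),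
    logIncrement_eq (g := fun t => F (1, t)) (by fun_prop) (fun t => he (1, t)),
    logIncrement_neg (g := fun s => F (s, 1)) (by fun_prop) (fun s => by rw [he (s, 1)]; ring),
    logIncrement_neg (g := fun s => F (s, 0)) (by fun_prop) (fun s => by rw [he (s, 0)]; ring)]
  refine ⟨by ring, ?_, ?_⟩
  · rw [Complex.exp_sub, he, he]
  · rw [Complex.exp_sub, he, he]

/-- A choice of logarithms of the differences of three points for which reversing the sign of a
difference changes the logarithm by exactly `π * I`, upwards from the increasing pairs. -/
theorem exists_difference_log (a : Fin 3 → ℂ) (ha : ∀ i k, i ≠ k → a i ≠ a k) :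
    ∃ A : Fin 3 → Fin 3 → ℂ, (∀ i k, i ≠ k → Complex.exp (A i k) = a k - a i) ∧
      ∀ i k, i < k → A k i = A i k + Real.pi * Complex.I := by
  refine ⟨fun i k => if i < k then Complex.log (a k - a i)
    else Complex.log (a i - a k) + Real.pi * Complex.I, fun i k hik => ?_, fun i k hik => ?_⟩
  · have h1 := sub_ne_zero.mpr (ha i k hik)
    have h2 := sub_ne_zero.mpr (ha k i hik.symm)
    simp only
    split_ifs
    · rw [Complex.exp_log h2]
    · rw [Complex.exp_add, Complex.exp_log h1, Complex.exp_pi_mul_I]; ring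
  · simp [hik, not_lt_of_gt hik]

/-- There is no drawing of `K₃,₃` in the plane in which disjoint edges have disjoint images. -/
theorem not_independent_drawing_K33 (a b : Fin 3 → ℂ) (p : Fin 3 → Fin 3 → ℝ → ℂ)
    (hp : ∀ i j, Continuous (p i j)) (h0 : ∀ i j, p i j 0 = a i) (h1 : ∀ i j, p i j 1 = b j)
    (hd : ∀ i j k l, i ≠ k → j ≠ l → ∀ s t, p i j s ≠ p k l t) : False := by
  have haa : ∀ i k, i ≠ k → a i ≠ a k := fun i k h => by
    have := hd i 0 k 1 h (by decide) 0 0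
    rwa [h0, h0] at this
  have hbb : ∀ j l, j ≠ l → b j ≠ b l := fun j l h => by
    have := hd 0 j 1 l (by decide) h 1 1
    rwa [h1, h1] at this
  have hab : ∀ i j, b j - a i ≠ 0 := fun i j => by
    obtain ⟨k, hk⟩ : ∃ k, i ≠ k := ⟨i + 1, by revert i; decide⟩
    obtain ⟨l, hl⟩ : ∃ l, l ≠ j := ⟨j + 1, by revert j; decide⟩
    have := hd i l k j hk hl 0 1
    rw [h0, h1] at this
    exact sub_ne_zero.mpr this.symm
  obtain ⟨A, hA, hA'⟩ := exists_difference_log a haa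
  obtain ⟨B, hB, hB'⟩ := exists_difference_log b hbb
  have hx : ∀ i k l, i ≠ k → ∃ m : ℤ, logIncrement (fun t => p k l t - a i) =
      Complex.log (b l - a i) - A i k + m * (2 * Real.pi * Complex.I) := by
    intro i k l hik
    apply Complex.exp_eq_exp_iff_exists_int.mp
    obtain ⟨j, hj⟩ : ∃ j, j ≠ l := ⟨l + 1, by revert l; decide⟩
    have := (logIncrement_square (hp i j) (hp k l) (hd i j k l hik hj)).2.1
    rw [h0, h0, h1] at this
    rw [this, Complex.exp_sub, Complex.exp_log (hab i l), hA i k hik]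
  have hy : ∀ j k l, j ≠ l → ∃ m : ℤ, logIncrement (fun t => p k l t - b j) =
      B j l - (Complex.log (b j - a k) + Real.pi * Complex.I)
        + m * (2 * Real.pi * Complex.I) := by
    intro j k l hjl
    apply Complex.exp_eq_exp_iff_exists_int.mp
    obtain ⟨i, hi⟩ : ∃ i, i ≠ k := ⟨k + 1, by revert k; decide⟩
    have := (logIncrement_square (hp i j) (hp k l) (hd i j k l hi hjl)).2.2
    rw [h1, h0, h1] at this
    rw [this, Complex.exp_sub, Complex.exp_add, Complex.exp_log (hab k j), hB j l hjl,
      Complex.exp_pi_mul_I]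
    congr 1; ring
  have hx' : ∀ i k l, ∃ m : ℤ, i ≠ k → logIncrement (fun t => p k l t - a i) =
      Complex.log (b l - a i) - A i k + m * (2 * Real.pi * Complex.I) := fun i k l => by
    by_cases h : i = k
    · exact ⟨0, fun h' => absurd h h'⟩
    · exact (hx i k l h).imp fun m hm _ => hm
  have hy' : ∀ j k l, ∃ m : ℤ, j ≠ l → logIncrement (fun t => p k l t - b j) =
      B j l - (Complex.log (b j - a k) + Real.pi * Complex.I)
        + m * (2 * Real.pi * Complex.I) := fun j k l => by
    by_cases h : j = l
    · exact ⟨0, fun h' => absurd h h'⟩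
    · exact (hy j k l h).imp fun m hm _ => hm
  choose m hm using hx'
  choose n hn using hy'
  have key : ∀ i j k l, i ≠ k → j ≠ l →
      (A k i - A i k) - (B j l - B l j) =
        (n j k l - n l i j - m i k l + m k i j : ℤ) * (2 * Real.pi * Complex.I) := by
    intro i j k l hik hjl
    have h := (logIncrement_square (hp i j) (hp k l) (hd i j k l hik hjl)).1
    rw [h0, h0, h1, h1, hm i k l hik, hn l i j hjl.symm, hm k i j hik.symm, hn j k l hjl] at h
    push_cast
    linear_combination h
  have key1 : ∀ i j k l, i < k → j < l → n j k l - n l i j - m i k l + m k i j = 1 := by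
    intro i j k l hik hjl
    have h := key i j k l hik.ne hjl.ne
    rw [hA' i k hik, hB' j l hjl] at h
    have h' : ((n j k l - n l i j - m i k l + m k i j : ℤ) : ℂ) * (2 * Real.pi * Complex.I)
        = 1 * (2 * Real.pi * Complex.I) := by rw [← h]; ring
    exact_mod_cast mul_right_cancel₀ Complex.two_pi_I_ne_zero h'
  have key2 : ∀ i j k l, i < k → l < j → n j k l - n l i j - m i k l + m k i j = 0 := by
    intro i j k l hik hjl
    have h := key i j k l hik.ne hjl.ne'
    rw [hA' i k hik, hB' l j hjl] at h
    have h' : ((n j k l - n l i j - m i k l + m k i j : ℤ) : ℂ) * (2 * Real.pi * Complex.I)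
        = 0 * (2 * Real.pi * Complex.I) := by rw [← h]; ring
    exact_mod_cast mul_right_cancel₀ Complex.two_pi_I_ne_zero h'
  have e1 := fun i k (h : i < k) => key1 i 0 k 1 h (by decide)
  have e2 := fun i k (h : i < k) => key1 i 0 k 2 h (by decide)
  have e3 := fun i k (h : i < k) => key1 i 1 k 2 h (by decide)
  have e4 := fun i k (h : i < k) => key2 i 1 k 0 h (by decide)
  have e5 := fun i k (h : i < k) => key2 i 2 k 0 h (by decide)
  have e6 := fun i k (h : i < k) => key2 i 2 k 1 h (by decide)
  have f : ∀ i k : Fin 3, i < k → _ := fun i k h =>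
    congrArg₂ (· + ·) (congrArg₂ (· + ·) (congrArg₂ (· + ·) (e1 i k h) (e2 i k h))
      (congrArg₂ (· + ·) (e3 i k h) (e4 i k h))) (congrArg₂ (· + ·) (e5 i k h) (e6 i k h))
  have f1 := f 0 1 (by decide)
  have f2 := f 0 2 (by decide)
  have f3 := f 1 2 (by decide)
  omega

/-- A planar graph contains no `K₃,₃` whose edges may be subdivided once, where only the images of
disjoint edges of `K₃,₃` are required to be disjoint. -/
theorem IsPlanarGraph.not_subdivided_K33 {V : Type*} {G : SimpleGraph V} (hG : IsPlanarGraph G)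
    (r w : Fin 3 → V) (x : Fin 3 → Fin 3 → V)
    (hx : ∀ i l, (x i l = r i ∨ G.Adj (r i) (x i l)) ∧ G.Adj (x i l) (w l))
    (hd : ∀ i l k m, i ≠ k → l ≠ m →
      Disjoint ({r i, x i l, w l} : Set V) {r k, x k m, w m}) : False := by
  obtain ⟨pos, γ, hpos, -, -, -, hγ⟩ := hG
  have hq : ∀ i l, ∃ q : Path (pos (r i)) (pos (w l)), ∀ y ∈ Set.range q,
      ∃ a b, ∃ h : G.Adj a b, y ∈ Set.range (γ a b h) ∧
        a ∈ ({r i, x i l, w l} : Set V) ∧ b ∈ ({r i, x i l, w l} : Set V) := by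
    intro i l
    obtain ⟨h1 | h1, h2⟩ := hx i l
    · have h3 : G.Adj (r i) (w l) := h1 ▸ h2
      exact ⟨γ _ _ h3, fun y hy => ⟨_, _, h3, hy, by simp, by simp⟩⟩
    · refine ⟨(γ _ _ h1).trans (γ _ _ h2), fun y hy => ?_⟩
      rw [Path.trans_range] at hy
      rcases hy with hy | hy
      · exact ⟨_, _, h1, hy, by simp, by simp⟩
      · exact ⟨_, _, h2, hy, by simp, by simp⟩
  choose q hq using hq
  let φ := Complex.equivRealProdCLM.symm
  refine not_independent_drawing_K33 (fun i => φ (pos (r i))) (fun l => φ (pos (w l)))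
    (fun i l s => φ ((q i l).extend s))
    (fun i l => φ.continuous.comp (q i l).continuous_extend) (fun i l => by simp)
    (fun i l => by simp) ?_
  intro i l k m hik hlm s t hst
  have hst' : (q i l).extend s = (q k m).extend t := φ.injective hst
  have hmem : ∀ i l s, (q i l).extend s ∈ Set.range (q i l) := fun i l s => by
    rw [← Path.extend_range]; exact ⟨s, rfl⟩
  obtain ⟨a, b, h, hy, ha, hb⟩ := hq i l _ (hmem i l s)
  obtain ⟨a', b', h', hy', ha', hb'⟩ := hq k m _ (hmem k m t)
  have hne : ∀ c ∈ ({r i, x i l, w l} : Set V), ∀ c' ∈ ({r k, x k m, w m} : Set V), c ≠ c' :=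
    fun c hc c' hc' => (hd i l k m hik hlm).ne_of_mem hc hc'
  have hs : s(a, b) ≠ s(a', b') := by
    intro h
    rcases Sym2.eq_iff.mp h with h | h
    · exact hne a ha a' ha' h.1
    · exact hne a ha b' hb' h.1
  rw [← hst'] at hy'
  obtain ⟨h3, h4⟩ := hγ a b a' b' h h' hs ⟨hy, hy'⟩
  simp only [Set.mem_insert_iff, Set.mem_singleton_iff] at h3 h4
  rcases h3 with h3 | h3 <;> rcases h4 with h4 | h4 <;> rw [h3] at h4
  · exact hne a ha a' ha' (hpos h4)
  · exact hne a ha b' hb' (hpos h4)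
  · exact hne b hb a' ha' (hpos h4)
  · exact hne b hb b' hb' (hpos h4)

/-- In a planar graph, among the common neighbours of two vertices at most two can be reached from
a third vertex by paths of length at most two avoiding the other vertices involved. -/
theorem IsPlanarGraph.card_le_two {V : Type*} {G : SimpleGraph V} (hG : IsPlanarGraph G)
    (u v z : V) (S : Finset V) (huv : u ≠ v) (hzS : z ∉ S) (hzu : z ≠ u) (hzv : z ≠ v)
    (hS : ∀ w ∈ S, G.Adj u w ∧ G.Adj v w)
    (hz : ∀ w ∈ S, ∃ x, (x = z ∨ G.Adj z x) ∧ G.Adj x w ∧ x ∉ S ∧ x ≠ u ∧ x ≠ v) :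
    S.card ≤ 2 := by
  by_contra! hc
  obtain ⟨w, hw⟩ : ∃ w : Fin 3 → V, Function.Injective w ∧ ∀ l, w l ∈ S := by
    obtain ⟨a, ha, b, hb, c, hc, hab, hac, hbc⟩ := Finset.two_lt_card.mp hc
    refine ⟨![a, b, c], ?_, ?_⟩
    · intro i j; fin_cases i <;> fin_cases j <;> simp [hab, hac, hbc, hab.symm, hac.symm, hbc.symm]
    · intro i; fin_cases i <;> simp [ha, hb, hc]
  obtain ⟨hinj, hw⟩ := hw
  choose x hx hxw hxS hxu hxv using fun l => hz (w l) (hw l)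
  have hu : ∀ l, w l ≠ u := fun l => (hS _ (hw l)).1.ne'
  have hv : ∀ l, w l ≠ v := fun l => (hS _ (hw l)).2.ne'
  have hwz : ∀ l, w l ≠ z := fun l h => hzS (h ▸ hw l)
  have hwx : ∀ l m, w l ≠ x m := fun l m h => hxS m (h ▸ hw l)
  refine hG.not_subdivided_K33 ![u, v, z] w (fun i l => ![u, v, x l] i) ?_ ?_
  · intro i l
    fin_cases i
    · exact ⟨Or.inl rfl, (hS _ (hw l)).1⟩
    · exact ⟨Or.inl rfl, (hS _ (hw l)).2⟩
    · exact ⟨hx l, hxw l⟩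
  · intro i l k m hik hlm
    have hwl := hinj.ne hlm
    fin_cases i <;> fin_cases k <;>
      simp_all [Set.disjoint_left, eq_comm] <;> grind

/-- The data of an interval coloring, with colors `C` and largest color `f v` at each vertex `v`,
together with a path `P 0, …, P k` descending the levels of a distance-like function `d`, each of
whose steps maximizes `f` among all possible descending steps. -/
structure GreedyPath {V : Type*} (G : SimpleGraph V) (C : V → V → ℕ) (f d : V → ℕ) (P : ℕ → V)
    (k : ℕ) : Prop where
  symm : ∀ u v, C u v = C v u
  inj : ∀ {v x y}, G.Adj v x → G.Adj v y → C v x = C v y → x = y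
  interval : ∀ {v x j}, G.Adj v x → C v x ≤ j → j ≤ f v → ∃ y, G.Adj v y ∧ C v y = j
  le_max : ∀ {v x}, G.Adj v x → C v x ≤ f v
  lip : ∀ {u v}, G.Adj u v → d u ≤ d v + 1
  level : ∀ {i}, i ≤ k → d (P i) + i = k
  adj : ∀ {i}, i < k → G.Adj (P i) (P (i + 1))
  greedy : ∀ {i w}, i < k → G.Adj (P i) w → d w + 1 = d (P i) → f w ≤ f (P (i + 1))
  start : ∃ x, G.Adj (P 0) x ∧ C (P 0) x ≤ 1

/-- The largest color at the first `i` vertices of the path `P`. -/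
def prefixMax {V : Type*} (f : V → ℕ) (P : ℕ → V) (i : ℕ) : ℕ :=
  (Finset.range i).sup fun j => f (P j)

/-- The edge from `P i` to `x` has a color not present at the earlier vertices of the path. -/
def IsNewEdge {V : Type*} (G : SimpleGraph V) (C : V → V → ℕ) (f : V → ℕ) (P : ℕ → V) (k i : ℕ)
    (x : V) : Prop :=
  i ≤ k ∧ G.Adj (P i) x ∧ prefixMax f P i < C (P i) x

open Classical in
/-- The vertices joined by edges of new colors both to `P i` and to `P (i + 1)`. -/
noncomputable def doubles {V : Type*} [Fintype V] (G : SimpleGraph V) (C : V → V → ℕ) (f : V → ℕ)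
    (P : ℕ → V) (k i : ℕ) : Finset V :=
  {x | IsNewEdge G C f P k i x ∧ IsNewEdge G C f P k (i + 1) x}

open Classical in
/-- The number of pairs of adjacent vertices in `X × Y`. -/
noncomputable def edgeCount {V : Type*} (G : SimpleGraph V) (X Y : Finset V) : ℕ :=
  ∑ x ∈ X, (Y.filter (G.Adj x)).card

open Classical in
theorem edgeCount_comm {V : Type*} (G : SimpleGraph V) (X Y : Finset V) :
    edgeCount G X Y = edgeCount G Y X := by
  have := Finset.sum_card_bipartiteAbove_eq_sum_card_bipartiteBelow (s := X) (t := Y) G.Adj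
  simp only [Finset.bipartiteAbove, Finset.bipartiteBelow] at this
  simp only [edgeCount, this, G.adj_comm]

theorem le_prefixMax {V : Type*} (f : V → ℕ) (P : ℕ → V) {i j : ℕ} (h : j < i) :
    f (P j) ≤ prefixMax f P i :=
  Finset.le_sup (f := fun j => f (P j)) (Finset.mem_range.mpr h)

/-- A sum of differences between `s` distinct numbers above `m` and `s` distinct numbers
up to `m` is at least `s ^ 2`. -/
theorem sq_card_add_card_le_sum {V : Type*} (S : Finset V) (a b : V → ℕ) (m : ℕ)
    (ha : ∀ w ∈ S, a w ≤ m) (hb : ∀ w ∈ S, m < b w) (hai : Set.InjOn a S)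
    (hbi : Set.InjOn b S) :
    S.card ^ 2 + S.card ≤ ∑ w ∈ S, (b w + 1 - a w) := by
  classical
  have hai' : Set.InjOn (fun w => -(a w : ℤ)) S := fun x hx y hy h => hai hx hy (by simpa using h)
  have hbi' : Set.InjOn (fun w => (b w : ℤ)) S := fun x hx y hy h => hbi hx hy (by simpa using h)
  have h1 := Finset.sum_range_le_sum (s := S.image fun w => -(a w : ℤ)) (c := -m) (by
    simpa using ha)
  have h2 := Finset.sum_range_le_sum (s := S.image fun w => (b w : ℤ)) (c := m + 1) (by
    intro x hx
    obtain ⟨w, hw, rfl⟩ := Finset.mem_image.mp hx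
    exact_mod_cast hb w hw)
  rw [Finset.sum_image hai', Finset.card_image_of_injOn hai'] at h1
  rw [Finset.sum_image hbi', Finset.card_image_of_injOn hbi'] at h2
  have h3 : ∀ s : ℕ, ∑ n ∈ Finset.range s, (-(m : ℤ) + n) + ∑ n ∈ Finset.range s, ((m : ℤ) + 1 + n)
      = (s : ℤ) ^ 2 := by
    intro s
    induction s with
    | zero => simp
    | succ s ih => rw [Finset.sum_range_succ, Finset.sum_range_succ]; push_cast; linarith
  have h4 : ((∑ w ∈ S, (b w + 1 - a w) : ℕ) : ℤ) =
      ∑ w ∈ S, -(a w : ℤ) + ∑ w ∈ S, (b w : ℤ) + S.card := by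
    rw [← Finset.sum_add_distrib, Finset.card_eq_sum_ones, Nat.cast_sum, Nat.cast_sum,
      ← Finset.sum_add_distrib]
    refine Finset.sum_congr rfl fun w hw => ?_
    have := ha w hw
    have := hb w hw
    omega
  rw [Nat.cast_sum] at h4
  zify
  rw [h4]
  linarith [h3 S.card]

namespace GreedyPath

variable {V : Type*} {G : SimpleGraph V} {C : V → V → ℕ} {f d : V → ℕ} {P : ℕ → V} {k : ℕ}

theorem path_inj (h : GreedyPath G C f d P k) {i j : ℕ} (hi : i ≤ k) (hj : j ≤ k)
    (e : P i = P j) : i = j := by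
  have h1 := h.level hi
  have h2 := h.level hj
  rw [e] at h1
  omega

theorem newEdge_consecutive (h : GreedyPath G C f d P k) {i j : ℕ} {x : V}
    (hi : IsNewEdge G C f P k i x) (hj : IsNewEdge G C f P k j x) (hij : i < j) : j = i + 1 := by
  obtain ⟨hik, hai, -⟩ := hi
  obtain ⟨hjk, haj, hmj⟩ := hj
  have h1 := h.level hik
  have h2 := h.level hjk
  have h3 := h.lip hai
  have h4 := h.lip haj.symm
  by_contra hne
  have h5 : d x + 1 = d (P i) := by omega
  have h6 := h.greedy (by omega) hai h5
  have h7 := le_prefixMax f P (show i + 1 < j by omega)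
  have h8 := h.le_max haj.symm
  rw [h.symm] at h8
  omega

theorem newEdge_path (h : GreedyPath G C f d P k) {i j : ℕ} (hj : j ≤ k)
    (hi : IsNewEdge G C f P k i (P j)) : j = i + 1 := by
  obtain ⟨hik, hai, hm⟩ := hi
  have h1 := h.level hik
  have h2 := h.level hj
  have h3 := h.lip hai
  have h4 := h.lip hai.symm
  by_contra hne
  have h5 : i ≠ j := by rintro rfl; exact G.irrefl hai
  have h6 := le_prefixMax f P (show j < i by omega)
  have h7 := h.le_max hai.symm
  rw [h.symm] at h7
  omega

/-- Each color up to the largest color at the end of the path is the color of a new edge. -/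
theorem exists_newEdge (h : GreedyPath G C f d P k) {j : ℕ} (h1 : 1 ≤ j) (hj : j ≤ f (P k)) :
    ∃ i x, IsNewEdge G C f P k i x ∧ C (P i) x = j := by
  classical
  have hex : ∃ i, j ≤ f (P i) := ⟨k, hj⟩
  let i := Nat.find hex
  have hi : j ≤ f (P i) := Nat.find_spec hex
  have hik : i ≤ k := Nat.find_min' hex hj
  have hlt : prefixMax f P i < j := by
    rw [prefixMax, Finset.sup_lt_iff (show ⊥ < j from h1)]
    intro m hm
    exact not_le.mp (Nat.find_min hex (Finset.mem_range.mp hm))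
  obtain ⟨x, hx, hxj⟩ : ∃ x, G.Adj (P i) x ∧ C (P i) x ≤ j := by
    rcases Nat.eq_zero_or_pos i with h0 | hpos
    · obtain ⟨x, hx, hx1⟩ := h.start
      rw [h0]
      exact ⟨x, hx, by omega⟩
    · have hadj := h.adj (show i - 1 < k by omega)
      rw [show i - 1 + 1 = i by omega] at hadj
      have h2 := h.le_max hadj
      have h3 := le_prefixMax f P (show i - 1 < i by omega)
      rw [h.symm] at h2
      exact ⟨_, hadj.symm, by omega⟩
  obtain ⟨y, hy, hyj⟩ := h.interval hx hxj hi
  exact ⟨i, y, ⟨hik, hy, by omega⟩, hyj⟩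

variable [Fintype V]

theorem mem_doubles {i : ℕ} {x : V} : x ∈ doubles G C f P k i ↔
    IsNewEdge G C f P k i x ∧ IsNewEdge G C f P k (i + 1) x := by
  simp [doubles]

theorem doubles_index_unique (h : GreedyPath G C f d P k) {i j : ℕ} {x : V}
    (hi : x ∈ doubles G C f P k i) (hj : x ∈ doubles G C f P k j) : i = j := by
  rw [mem_doubles] at hi hj
  rcases lt_trichotomy i j with hij | hij | hij
  · have := h.newEdge_consecutive hi.1 hj.2 (by omega)
    omega
  · exact hij
  · have := h.newEdge_consecutive hj.1 hi.2 (by omega)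
    omega

theorem path_notMem_doubles (h : GreedyPath G C f d P k) {i j : ℕ} (hj : j ≤ k) :
    P j ∉ doubles G C f P k i := by
  intro hx
  rw [mem_doubles] at hx
  have h1 := h.newEdge_path hj hx.1
  have h2 := h.newEdge_path hj hx.2
  omega

theorem level_of_mem_doubles (h : GreedyPath G C f d P k) {i : ℕ} {x : V}
    (hx : x ∈ doubles G C f P k i) : i < k ∧ (d x + i = k ∨ d x + i + 1 = k) := by
  obtain ⟨⟨hik, hai, -⟩, ⟨hjk, haj, -⟩⟩ := mem_doubles.mp hx
  have h1 := h.level hik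
  have h2 := h.level hjk
  have h3 := h.lip hai
  have h4 := h.lip haj.symm
  omega

open Classical in
theorem color_le (h : GreedyPath G C f d P k) :
    f (P k) + 1 ≤ Fintype.card V + ∑ i ∈ Finset.range k, (doubles G C f P k i).card := by
  set D := (Finset.range k).biUnion (doubles G C f P k) with hD
  have hDc : D.card ≤ ∑ i ∈ Finset.range k, (doubles G C f P k i).card := Finset.card_biUnion_le
  have hcount : ∀ x, ((Finset.range (k + 1)).filter (IsNewEdge G C f P k · x)).card ≤
      (if x = P 0 then 0 else 1) + if x ∈ D then 1 else 0 := by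
    intro x
    by_cases hx0 : x = P 0
    · rw [Finset.card_eq_zero.mpr]
      · omega
      · refine Finset.filter_eq_empty_iff.mpr fun i _ hi => ?_
        rw [hx0] at hi
        have := h.newEdge_path (Nat.zero_le k) hi
        omega
    rw [if_neg hx0]
    by_cases hxD : x ∈ D
    · rw [if_pos hxD]
      by_contra! hc
      obtain ⟨a, ha, b, hb, c, hc, hab, hac, hbc⟩ := Finset.two_lt_card.mp hc
      simp only [Finset.mem_filter] at ha hb hc
      have key : ∀ {i j}, IsNewEdge G C f P k i x → IsNewEdge G C f P k j x → i ≠ j →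
          j = i + 1 ∨ i = j + 1 := by
        intro i j hi hj hij
        rcases lt_or_gt_of_ne hij with hlt | hlt
        · exact Or.inl (h.newEdge_consecutive hi hj hlt)
        · exact Or.inr (h.newEdge_consecutive hj hi hlt)
      have h1 := key ha.2 hb.2 hab
      have h2 := key ha.2 hc.2 hac
      have h3 := key hb.2 hc.2 hbc
      omega
    · rw [if_neg hxD]
      have key : ∀ {i j}, IsNewEdge G C f P k i x → IsNewEdge G C f P k j x → ¬ i < j := by
        intro i j hi hj hlt
        obtain rfl := h.newEdge_consecutive hi hj hlt
        refine hxD (Finset.mem_biUnion.mpr ⟨i, Finset.mem_range.mpr ?_, mem_doubles.mpr ⟨hi, hj⟩⟩)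
        exact hj.1
      refine Finset.card_le_one.mpr fun i hi j hj => ?_
      rw [Finset.mem_filter] at hi hj
      have h1 := key hi.2 hj.2
      have h2 := key hj.2 hi.2
      omega
  have hN : f (P k) ≤ ∑ x : V, ((Finset.range (k + 1)).filter (IsNewEdge G C f P k · x)).card := by
    rw [← Finset.card_sigma]
    have hsub : Finset.Icc 1 (f (P k)) ⊆ (Finset.univ.sigma fun x : V =>
        (Finset.range (k + 1)).filter (IsNewEdge G C f P k · x)).image
          (fun p => C (P p.2) p.1) := by
      intro j hj
      rw [Finset.mem_Icc] at hj
      obtain ⟨i, x, hix, hc⟩ := h.exists_newEdge hj.1 hj.2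
      refine Finset.mem_image.mpr ⟨⟨x, i⟩, ?_, hc⟩
      have := hix.1
      simp only [Finset.mem_sigma, Finset.mem_univ, Finset.mem_filter, Finset.mem_range, true_and]
      exact ⟨by omega, hix⟩
    have := (Finset.card_le_card hsub).trans Finset.card_image_le
    rwa [Nat.card_Icc, Nat.add_sub_cancel] at this
  have hsum := Finset.sum_le_sum fun x (_ : x ∈ (Finset.univ : Finset V)) => hcount x
  rw [Finset.sum_add_distrib] at hsum
  have h1 : ∑ x : V, (if x = P 0 then 0 else 1) + 1 = Fintype.card V := by
    rw [← Finset.card_univ, Finset.card_eq_sum_ones,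
      ← Finset.add_sum_erase _ _ (Finset.mem_univ (P 0)),
      ← Finset.add_sum_erase _ _ (Finset.mem_univ (P 0))]
    rw [if_pos rfl, zero_add, add_comm]
    congr 1
    exact Finset.sum_congr rfl fun x hx => if_neg (Finset.ne_of_mem_erase hx)
  have h2 : ∑ x : V, (if x ∈ D then 1 else 0) = D.card := by simp
  omega

/-- The consequence of planarity used below: among the common neighbours of two vertices at most
two can be reached from a third vertex by avoiding paths of length at most two. -/
def FewReachable (G : SimpleGraph V) : Prop :=
  ∀ (u v z : V) (S : Finset V), u ≠ v → z ∉ S → z ≠ u → z ≠ v →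
    (∀ w ∈ S, G.Adj u w ∧ G.Adj v w) →
    (∀ w ∈ S, ∃ x, (x = z ∨ G.Adj z x) ∧ G.Adj x w ∧ x ∉ S ∧ x ≠ u ∧ x ≠ v) → S.card ≤ 2

open Classical in
theorem card_filter_adj_le (h : GreedyPath G C f d P k) (hG : FewReachable G) {i : ℕ} {z : V}
    (hz0 : z ≠ P i) (hz1 : z ≠ P (i + 1)) :
    ((doubles G C f P k i).filter (G.Adj z)).card ≤ 2 := by
  by_cases hik : i < k
  · refine hG (P i) (P (i + 1)) z _ (h.adj hik).ne (by simp) hz0 hz1 (fun w hw => ?_) fun w hw => ?_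
    · have := mem_doubles.mp (Finset.mem_filter.mp hw).1
      exact ⟨this.1.2.1, this.2.2.1⟩
    · exact ⟨z, Or.inl rfl, (Finset.mem_filter.mp hw).2, by simp, hz0, hz1⟩
  · rw [Finset.card_eq_zero.mpr]
    · omega
    · exact Finset.filter_eq_empty_iff.mpr fun w hw => absurd (h.level_of_mem_doubles hw).1 hik

open Classical in
theorem card_doubles_adj_doubles_le (h : GreedyPath G C f d P k) (hG : FewReachable G) {i j : ℕ}
    (hij : i ≠ j) :
    ((doubles G C f P k i).filter fun w => ∃ x ∈ doubles G C f P k j, G.Adj w x).card ≤ 2 := by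
  by_cases hik : i < k
  swap
  · rw [Finset.card_eq_zero.mpr]
    · omega
    · exact Finset.filter_eq_empty_iff.mpr fun w hw => absurd (h.level_of_mem_doubles hw).1 hik
  by_cases hjk : j < k
  swap
  · rw [Finset.card_eq_zero.mpr]
    · omega
    · refine Finset.filter_eq_empty_iff.mpr fun w _ hx => ?_
      obtain ⟨x, hx, -⟩ := hx
      exact hjk (h.level_of_mem_doubles hx).1
  have key : ∀ m ≤ k, m ≠ i → m ≠ i + 1 → (∀ x ∈ doubles G C f P k j, G.Adj (P m) x) →
      ((doubles G C f P k i).filter fun w => ∃ x ∈ doubles G C f P k j, G.Adj w x).card ≤ 2 := by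
    intro m hm hmi hmi' hadj
    refine hG (P i) (P (i + 1)) (P m) _ (h.adj hik).ne
      (fun hP => h.path_notMem_doubles hm (Finset.mem_filter.mp hP).1)
      (fun e => hmi (h.path_inj hm hik.le e)) (fun e => hmi' (h.path_inj hm hik e))
      (fun w hw => ?_) fun w hw => ?_
    · have := mem_doubles.mp (Finset.mem_filter.mp hw).1
      exact ⟨this.1.2.1, this.2.2.1⟩
    · obtain ⟨x, hx, hwx⟩ := (Finset.mem_filter.mp hw).2
      refine ⟨x, Or.inr (hadj x hx), hwx.symm, fun hxS => ?_, ?_, ?_⟩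
      · exact hij (h.doubles_index_unique (Finset.mem_filter.mp hxS).1 hx)
      · rintro rfl
        exact h.path_notMem_doubles hik.le hx
      · rintro rfl
        exact h.path_notMem_doubles hik hx
  rcases lt_or_gt_of_ne hij with hlt | hlt
  · exact key (j + 1) hjk (by omega) (by omega) fun x hx => (mem_doubles.mp hx).2.2.1
  · exact key j hjk.le (by omega) (by omega) fun x hx => (mem_doubles.mp hx).1.2.1

open Classical in
theorem edgeCount_doubles_le (h : GreedyPath G C f d P k) (hG : FewReachable G) {i j : ℕ}
    (hij : i ≠ j) : edgeCount G (doubles G C f P k i) (doubles G C f P k j) ≤ 4 := by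
  set S := (doubles G C f P k i).filter fun w => ∃ x ∈ doubles G C f P k j, G.Adj w x with hS
  set T := (doubles G C f P k j).filter fun w => ∃ x ∈ doubles G C f P k i, G.Adj w x with hT
  have h1 : S.card ≤ 2 := h.card_doubles_adj_doubles_le hG hij
  have h2 : T.card ≤ 2 := h.card_doubles_adj_doubles_le hG hij.symm
  calc edgeCount G (doubles G C f P k i) (doubles G C f P k j)
      = ∑ w ∈ S, ((doubles G C f P k j).filter (G.Adj w)).card := by
        refine (Finset.sum_subset (Finset.filter_subset _ _) fun w hw hwS => ?_).symm
        rw [Finset.card_eq_zero]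
        refine Finset.filter_eq_empty_iff.mpr fun x hx hwx => ?_
        exact hwS (Finset.mem_filter.mpr ⟨hw, x, hx, hwx⟩)
    _ ≤ ∑ w ∈ S, 2 := by
        refine Finset.sum_le_sum fun w hw => le_trans (Finset.card_le_card fun x hx => ?_) h2
        rw [Finset.mem_filter] at hx hw ⊢
        exact ⟨hx.1, w, hw.1, hx.2.symm⟩
    _ ≤ 4 := by rw [Finset.sum_const, smul_eq_mul]; omega

open Classical in
/-- The vertices neither on the path nor joined to it by two edges of new colors. -/
noncomputable def rest (G : SimpleGraph V) (C : V → V → ℕ) (f : V → ℕ) (P : ℕ → V) (k : ℕ) :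
    Finset V :=
  {x | (∀ j ≤ k, x ≠ P j) ∧ ∀ j, x ∉ doubles G C f P k j}

open Classical in
/-- A vertex joined to `w ∈ doubles G C f P k i` by an edge whose color lies between those of the
edges from `w` to `P i` and `P (i + 1)` belongs to one of a few classes. -/
theorem mem_classes (h : GreedyPath G C f d P k) {i : ℕ} {w x : V}
    (hw : w ∈ doubles G C f P k i) (hwx : G.Adj w x) (hC : C (P i) w ≤ C w x) :
    x ∈ ({P i, P (i + 1)} : Finset V) ∨ (i + 2 ≤ k ∧ x = P (i + 2)) ∨ x ∈ doubles G C f P k i ∨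
      x ∈ doubles G C f P k (i + 1) ∨ x ∈ doubles G C f P k (i + 2) ∨
      (1 ≤ i ∧ x ∈ doubles G C f P k (i - 1)) ∨ x ∈ rest G C f P k := by
  obtain ⟨⟨hi, hai, hmi⟩, hj, haj, hmj⟩ := mem_doubles.mp hw
  obtain ⟨hik, hdw⟩ := h.level_of_mem_doubles hw
  have hd1 := h.lip hwx
  have hd2 := h.lip hwx.symm
  by_cases hx : ∃ j ≤ k, x = P j
  · obtain ⟨j, hjk, rfl⟩ := hx
    have hl := h.level hjk
    obtain rfl | rfl | rfl | hj1 : j = i ∨ j = i + 1 ∨ j = i + 2 ∨ j + 1 = i := by omega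
    · simp
    · simp
    · exact Or.inr (Or.inl ⟨hjk, rfl⟩)
    · have h1 := h.greedy (show j < k by omega) hwx.symm (by omega)
      have h2 := h.le_max haj.symm
      have h3 := le_prefixMax f P (show i < i + 1 by omega)
      rw [h.symm] at h2
      rw [hj1] at h1
      omega
  by_cases hx' : ∃ j, x ∈ doubles G C f P k j
  · obtain ⟨j, hjx⟩ := hx'
    obtain ⟨hjk, hdx⟩ := h.level_of_mem_doubles hjx
    obtain rfl | rfl | rfl | hj1 | hj2 : j = i ∨ j = i + 1 ∨ j = i + 2 ∨ j + 1 = i ∨ j + 2 = i := by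
      omega
    · tauto
    · tauto
    · tauto
    · rw [show j = i - 1 by omega] at hjx
      have : 1 ≤ i := by omega
      tauto
    · have hl := h.level hjk.le
      have h1 := h.greedy hjk (mem_doubles.mp hjx).1.2.1 (by omega)
      have h2 := h.le_max hwx.symm
      have h3 := le_prefixMax f P (show j + 1 < i by omega)
      rw [h.symm] at h2
      omega
  · push Not at hx hx'
    have : x ∈ rest G C f P k := by
      simp only [rest, Finset.mem_filter, Finset.mem_univ, true_and]
      exact ⟨hx, hx'⟩
    tauto

open Classical in
theorem sq_card_doubles_le (h : GreedyPath G C f d P k) (hG : FewReachable G) (i : ℕ) :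
    (doubles G C f P k i).card ^ 2 + (doubles G C f P k i).card ≤
      4 * (doubles G C f P k i).card + 14 +
        edgeCount G (doubles G C f P k i) (rest G C f P k) := by
  set W := doubles G C f P k with hW
  have hlow : (W i).card ^ 2 + (W i).card ≤
      ∑ w ∈ W i, (C (P (i + 1)) w + 1 - C (P i) w) := by
    refine sq_card_add_card_le_sum (W i) (C (P i)) (C (P (i + 1))) (f (P i))
      (fun w hw => ?_) (fun w hw => ?_) (fun w hw x hx e => ?_) (fun w hw x hx e => ?_)
    · exact h.le_max (mem_doubles.mp hw).1.2.1
    · exact (le_prefixMax f P (Nat.lt_succ_self i)).trans_lt (mem_doubles.mp hw).2.2.2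
    · exact h.inj (mem_doubles.mp hw).1.2.1 (mem_doubles.mp hx).1.2.1 e
    · exact h.inj (mem_doubles.mp hw).2.2.1 (mem_doubles.mp hx).2.2.1 e
  set U := if 1 ≤ i then W (i - 1) else ∅ with hU
  set Z : Finset V := if i + 2 ≤ k then {P (i + 2)} else ∅ with hZ
  have hpt : ∀ w ∈ W i, C (P (i + 1)) w + 1 - C (P i) w ≤
      2 + (Z.filter (G.Adj w)).card + ((W i).filter (G.Adj w)).card +
        ((W (i + 1)).filter (G.Adj w)).card + ((W (i + 2)).filter (G.Adj w)).card +
        (U.filter (G.Adj w)).card + ((rest G C f P k).filter (G.Adj w)).card := by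
    intro w hw
    obtain ⟨⟨hi, hai, hmi⟩, hj, haj, hmj⟩ := mem_doubles.mp hw
    have hsub : Finset.Icc (C (P i) w) (C (P (i + 1)) w) ⊆
        (({P i, P (i + 1)} ∪ Z.filter (G.Adj w) ∪ (W i).filter (G.Adj w) ∪
        (W (i + 1)).filter (G.Adj w) ∪ (W (i + 2)).filter (G.Adj w) ∪
        U.filter (G.Adj w) ∪ (rest G C f P k).filter (G.Adj w) : Finset V)).image (C w) := by
      intro j hj
      rw [Finset.mem_Icc] at hj
      have hle := h.le_max haj.symm
      rw [h.symm] at hle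
      obtain ⟨x, hwx, hxj⟩ := h.interval hai.symm (by rw [h.symm]; exact hj.1) (hj.2.trans hle)
      refine Finset.mem_image.mpr ⟨x, ?_, hxj⟩
      have := h.mem_classes hw hwx (by rw [hxj]; exact hj.1)
      simp only [Finset.mem_union, Finset.mem_filter]
      rcases this with h1 | ⟨h1, rfl⟩ | h1 | h1 | h1 | ⟨h1, h2⟩ | h1
      · tauto
      · have : P (i + 2) ∈ Z := by simp [hZ, h1]
        tauto
      · tauto
      · tauto
      · tauto
      · have : x ∈ U := by simpa [hU, h1] using h2
        tauto
      · tauto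
    have hcard := (Finset.card_le_card hsub).trans Finset.card_image_le
    rw [Nat.card_Icc] at hcard
    refine hcard.trans ?_
    refine (Finset.card_union_le _ _).trans (Nat.add_le_add_right ?_ _)
    refine (Finset.card_union_le _ _).trans (Nat.add_le_add_right ?_ _)
    refine (Finset.card_union_le _ _).trans (Nat.add_le_add_right ?_ _)
    refine (Finset.card_union_le _ _).trans (Nat.add_le_add_right ?_ _)
    refine (Finset.card_union_le _ _).trans (Nat.add_le_add_right ?_ _)
    exact (Finset.card_union_le _ _).trans (Nat.add_le_add_right Finset.card_le_two _)
  have hup := Finset.sum_le_sum hpt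
  simp only [Finset.sum_add_distrib, Finset.sum_const, smul_eq_mul] at hup
  have e1 : ∑ w ∈ W i, (Z.filter (G.Adj w)).card ≤ 2 := by
    change edgeCount G (W i) Z ≤ 2
    rw [edgeCount_comm, hZ]
    split_ifs with hk
    · rw [edgeCount, Finset.sum_singleton]
      refine h.card_filter_adj_le hG (fun e => ?_) (fun e => ?_)
      · have := h.path_inj hk (by omega) e; omega
      · have := h.path_inj hk (by omega) e; omega
    · simp [edgeCount]
  have e2 : ∑ w ∈ W i, ((W i).filter (G.Adj w)).card ≤ (W i).card * 2 := by
    refine Finset.sum_le_card_nsmul _ _ _ fun w hw => ?_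
    obtain ⟨⟨hi, hai, hmi⟩, hj, haj, hmj⟩ := mem_doubles.mp hw
    exact h.card_filter_adj_le hG hai.ne' haj.ne'
  have e3 : ∑ w ∈ W i, ((W (i + 1)).filter (G.Adj w)).card ≤ 4 :=
    h.edgeCount_doubles_le hG (by omega)
  have e4 : ∑ w ∈ W i, ((W (i + 2)).filter (G.Adj w)).card ≤ 4 :=
    h.edgeCount_doubles_le hG (by omega)
  have e5 : ∑ w ∈ W i, (U.filter (G.Adj w)).card ≤ 4 := by
    rw [hU]
    split_ifs with hi
    · exact h.edgeCount_doubles_le hG (by omega)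
    · simp
  have e6 : ∑ w ∈ W i, ((rest G C f P k).filter (G.Adj w)).card =
    edgeCount G (W i) (rest G C f P k) := rfl
  omega

open Classical in
theorem sum_edgeCount_rest_le (h : GreedyPath G C f d P k) (hG : FewReachable G) :
    ∑ i ∈ Finset.range k, edgeCount G (doubles G C f P k i) (rest G C f P k) ≤
      8 * (rest G C f P k).card := by
  simp_rw [edgeCount_comm G _ (rest G C f P k), edgeCount]
  rw [Finset.sum_comm, mul_comm]
  refine Finset.sum_le_card_nsmul _ _ _ fun x hx => ?_
  have hx' := (Finset.mem_filter.mp hx).2.1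
  calc ∑ i ∈ Finset.range k, ((doubles G C f P k i).filter (G.Adj x)).card
      ≤ ∑ i ∈ Finset.range k, if i ∈ Finset.Icc (k - d x - 2) (k + 1 - d x) then 2 else 0 := by
        refine Finset.sum_le_sum fun i hi => ?_
        have hik := Finset.mem_range.mp hi
        split_ifs with hm
        · exact h.card_filter_adj_le hG (hx' i hik.le) (hx' (i + 1) hik)
        · rw [Nat.le_zero, Finset.card_eq_zero]
          refine Finset.filter_eq_empty_iff.mpr fun w hw hxw => hm ?_
          have h1 := (h.level_of_mem_doubles hw).2
          have h2 := h.lip hxw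
          have h3 := h.lip hxw.symm
          rw [Finset.mem_Icc]
          omega
    _ = ((Finset.range k).filter (· ∈ Finset.Icc (k - d x - 2) (k + 1 - d x))).card * 2 := by
        rw [← Finset.sum_filter, Finset.sum_const, smul_eq_mul]
    _ ≤ (Finset.Icc (k - d x - 2) (k + 1 - d x)).card * 2 := by
        refine Nat.mul_le_mul_right _ (Finset.card_le_card fun i hi => ?_)
        exact (Finset.mem_filter.mp hi).2
    _ ≤ 8 := by
        rw [Nat.card_Icc]
        omega

open Classical in
theorem card_eq (h : GreedyPath G C f d P k) :
    Fintype.card V = k + 1 + ∑ i ∈ Finset.range k, (doubles G C f P k i).card +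
      (rest G C f P k).card := by
  set D := (Finset.range k).biUnion (doubles G C f P k) with hD
  have hDc : D.card = ∑ i ∈ Finset.range k, (doubles G C f P k i).card := by
    refine Finset.card_biUnion fun i _ j _ hij => Finset.disjoint_left.mpr fun x hi hj => ?_
    exact hij (h.doubles_index_unique hi hj)
  have hPc : ((Finset.range (k + 1)).image P).card = k + 1 := by
    rw [Finset.card_image_of_injOn, Finset.card_range]
    intro i hi j hj e
    simp only [Finset.coe_range, Set.mem_Iio] at hi hj
    exact h.path_inj (by omega) (by omega) e
  have hdis : Disjoint ((Finset.range (k + 1)).image P) D := by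
    refine Finset.disjoint_left.mpr fun x hx hxD => ?_
    obtain ⟨j, hj, rfl⟩ := Finset.mem_image.mp hx
    obtain ⟨i, -, hi⟩ := Finset.mem_biUnion.mp hxD
    exact h.path_notMem_doubles (by have := Finset.mem_range.mp hj; omega) hi
  have hrest : rest G C f P k = ((Finset.range (k + 1)).image P ∪ D)ᶜ := by
    ext x
    simp only [rest, Finset.mem_filter, Finset.mem_univ, true_and, Finset.mem_compl,
      Finset.mem_union, not_or, hD, Finset.mem_biUnion, Finset.mem_image, Finset.mem_range,
      not_exists, not_and]
    refine and_congr ⟨fun hx j hj e => hx j (by omega) e.symm,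
      fun hx j hj e => hx j (by omega) e.symm⟩ ⟨fun hx j _ => hx j, fun hx j hj => ?_⟩
    exact hx j (h.level_of_mem_doubles hj).1 hj
  have hcard := Finset.card_add_card_compl ((Finset.range (k + 1)).image P ∪ D)
  rw [Finset.card_union_of_disjoint hdis, hPc, hDc] at hcard
  rw [hrest]
  exact hcard.symm

theorem six_mul_color_le (h : GreedyPath G C f d P k) (hG : FewReachable G) :
    6 * f (P k) ≤ 11 * Fintype.card V := by
  have h1 := h.color_le
  have h2 := h.card_eq
  have h3 := h.sum_edgeCount_rest_le hG
  have h4 : ∑ i ∈ Finset.range k, 2 * (doubles G C f P k i).card ≤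
      ∑ i ∈ Finset.range k, (10 + edgeCount G (doubles G C f P k i) (rest G C f P k)) := by
    refine Finset.sum_le_sum fun i _ => ?_
    have := h.sq_card_doubles_le hG i
    by_cases h5 : (doubles G C f P k i).card ≤ 5
    · omega
    · nlinarith
  rw [← Finset.mul_sum, Finset.sum_add_distrib, Finset.sum_const, Finset.card_range,
    smul_eq_mul] at h4
  omega

end GreedyPath

open Classical in
theorem IsPlanarGraph.six_mul_le_of_isIntervalColoring {V : Type*} [Fintype V] {G : SimpleGraph V}
    (hplanar : IsPlanarGraph G) (hconn : G.Connected) {t : ℕ} (ht : 1 ≤ t) {c : Sym2 V → ℕ}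
    (hc : IsIntervalColoring G t c) : 6 * t ≤ 11 * Fintype.card V := by
  obtain ⟨-, hsurj, hinj, hinterval⟩ := hc
  have exists_adj : ∀ i, 1 ≤ i → i ≤ t → ∃ u v, G.Adj u v ∧ c s(u, v) = i := fun i h1 h2 => by
    obtain ⟨e, he, hi⟩ := hsurj i (Finset.mem_Icc.mpr ⟨h1, h2⟩)
    induction e with | _ u v => exact ⟨u, v, he, hi⟩
  obtain ⟨u, x₀, hux₀, hu⟩ := exists_adj 1 le_rfl ht
  obtain ⟨τ, y₀, hτy₀, hτ⟩ := exists_adj t ht le_rfl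
  let f : V → ℕ := fun v => Finset.univ.sup fun x => if G.Adj v x then c s(v, x) else 0
  have le_f : ∀ {v x}, G.Adj v x → c s(v, x) ≤ f v := fun {v x} hvx => by
    simpa [hvx] using Finset.le_sup (f := fun x => if G.Adj v x then c s(v, x) else 0)
      (Finset.mem_univ x)
  have f_attained : ∀ {v x}, G.Adj v x → ∃ y, G.Adj v y ∧ f v = c s(v, y) := fun {v x} hvx => by
    obtain ⟨y, -, hy⟩ := Finset.exists_mem_eq_sup Finset.univ ⟨x, Finset.mem_univ x⟩
      fun x => if G.Adj v x then c s(v, x) else 0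
    by_cases hvy : G.Adj v y
    · exact ⟨y, hvy, by simpa [hvy] using hy⟩
    · refine ⟨x, hvx, le_antisymm ?_ (le_f hvx)⟩
      have hfv : f v = if G.Adj v y then c s(v, y) else 0 := hy
      rw [hfv, if_neg hvy]
      exact Nat.zero_le _
  let d : V → ℕ := fun v => G.dist v τ
  have lip : ∀ {u v}, G.Adj u v → d u ≤ d v + 1 := fun {u v} huv => by
    have h1 : G.dist u τ ≤ G.dist u v + G.dist v τ := hconn.dist_triangle
    rw [SimpleGraph.dist_eq_one_iff_adj.mpr huv] at h1
    change G.dist u τ ≤ G.dist v τ + 1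
    omega
  have exists_closer : ∀ v, 0 < d v → ∃ w, G.Adj v w ∧ d w + 1 = d v := fun v hv => by
    obtain ⟨p, hp⟩ := hconn.exists_walk_length_eq_dist v τ
    cases p with
    | nil => simp [d] at hv
    | @cons _ w _ hvw q =>
      refine ⟨w, hvw, le_antisymm ?_ (lip hvw)⟩
      have h1 : G.dist w τ ≤ q.length := SimpleGraph.dist_le q
      rw [SimpleGraph.Walk.length_cons] at hp
      change G.dist w τ + 1 ≤ G.dist v τ
      omega
  have exists_next : ∀ v, ∃ w, 0 < d v → G.Adj v w ∧ d w + 1 = d v ∧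
      ∀ x, G.Adj v x → d x + 1 = d v → f x ≤ f w := fun v => by
    by_cases hv : 0 < d v
    · obtain ⟨w, hw⟩ := exists_closer v hv
      obtain ⟨y, hy, hmax⟩ := Finset.exists_max_image
        (Finset.univ.filter fun w => G.Adj v w ∧ d w + 1 = d v) f ⟨w, by simpa using hw⟩
      have hy' : G.Adj v y ∧ d y + 1 = d v := by simpa using hy
      exact ⟨y, fun _ => ⟨hy'.1, hy'.2, fun x h1 h2 => hmax x (by simp [h1, h2])⟩⟩
    · exact ⟨v, fun h => absurd h hv⟩
  choose next hnext using exists_next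
  let P : ℕ → V := fun i => next^[i] u
  have P_succ : ∀ i, P (i + 1) = next (P i) := fun i => Function.iterate_succ_apply' next i u
  have level : ∀ i, i ≤ d u → d (P i) + i = d u := fun i => by
    induction i with
    | zero => exact fun _ => rfl
    | succ i ih =>
      intro hi
      have h1 := ih (by omega)
      have h2 := (hnext (P i) (by omega)).2.1
      rw [P_succ]
      omega
  have hP : P (d u) = τ := by
    have h1 : d (P (d u)) = 0 := by have := level (d u) le_rfl; omega
    exact hconn.dist_eq_zero_iff.mp h1
  have path : GreedyPath G (fun v x => c s(v, x)) f d P (d u) :=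
    { symm := fun u v => by rw [Sym2.eq_swap]
      inj := fun {v x y} hx hy h => Sym2.congr_right.mp (hinj v _ hx _ hy (by simp) (by simp) h)
      interval := fun {v x j} hvx h1 h2 => by
        obtain ⟨a, b, hab⟩ := hinterval v
        obtain ⟨y, hvy, hy⟩ := f_attained hvx
        have hx' : c s(v, x) ∈ Set.Icc a b := hab ▸ ⟨_, hvx, by simp, rfl⟩
        have hy' : c s(v, y) ∈ Set.Icc a b := hab ▸ ⟨_, hvy, by simp, rfl⟩
        have hj : j ∈ Set.Icc a b := ⟨hx'.1.trans h1, (h2.trans hy.le).trans hy'.2⟩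
        rw [← hab] at hj
        obtain ⟨e, he, hve, rfl⟩ := hj
        obtain ⟨z, rfl⟩ := hve
        exact ⟨z, he, rfl⟩
      le_max := le_f
      lip := lip
      level := fun {i} => level i
      adj := fun {i} hi => by
        have := level i hi.le
        rw [P_succ]
        exact (hnext (P i) (by omega)).1
      greedy := fun {i w} hi h1 h2 => by
        have := level i hi.le
        rw [P_succ]
        exact (hnext (P i) (by omega)).2.2 w h1 h2
      start := ⟨x₀, hux₀, hu.le⟩ }
  have h1 := path.six_mul_color_le hplanar.card_le_two
  have h2 := le_f hτy₀
  rw [hP] at h1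
  omega

/-- If `G` is a connected planar graph admitting an interval `t`-coloring for some
`t ≥ 1`, then `t ≤ (11/6) * |V(G)|`; hence `W(G) ≤ (11/6) * |V(G)|`. -/
theorem interval_coloring_planar_bound {V : Type*} [Fintype V]
    (G : SimpleGraph V) (hconn : G.Connected) (hplanar : IsPlanarGraph G)
    (t : ℕ) (ht : 1 ≤ t) (h : HasIntervalColoring G t) :
    (t : ℚ) ≤ 11 / 6 * Fintype.card V := by
  obtain ⟨c, hc⟩ := h
  have h1 : (6 * t : ℚ) ≤ 11 * Fintype.card V := by
    exact_mod_cast hplanar.six_mul_le_of_isIntervalColoring hconn ht hc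
  linarith
end

section
/- If G is a connected r-regular graph with |V(G)| ≥ 2r + 2 admitting an interval t-coloring for some t ≥ 1, then the greatest value W(G) of t for which G has an interval t-coloring satisfies W(G) ≤ 2|V(G)| − 5. -/
open SimpleGraph in
/-- A geodesic from `a` to `w` each of whose edges, read backwards from `w`, has the largest
color among the edges that continue towards `a`. -/
lemma exists_color_maximal_geodesic {V : Type*} [Fintype V] {G : SimpleGraph V}
    (hconn : G.Connected) (c : Sym2 V → ℕ) (a : V) :
    ∀ (d : ℕ) (w : V), G.dist a w = d → ∃ p : ℕ → V, p d = w ∧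
      (∀ i ≤ d, G.dist a (p i) = i) ∧ (∀ i < d, G.Adj (p i) (p (i + 1))) ∧
      (∀ i < d, ∀ x, G.Adj x (p (i + 1)) → G.dist a x = i →
        c s(x, p (i + 1)) ≤ c s(p i, p (i + 1))) := by
  classical
  intro d
  induction d with
  | zero =>
    intro w hw
    exact ⟨fun _ => w, rfl, fun i hi => by rw [Nat.le_zero.1 hi, hw], by simp, by simp⟩
  | succ d ih =>
    intro w hw
    have hne : (Finset.univ.filter fun x => G.Adj x w ∧ G.dist a x = d).Nonempty := by
      obtain ⟨q, hq⟩ := hconn.exists_walk_length_eq_dist w a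
      cases q with
      | nil => simp at hw
      | @cons _ x _ hadj q =>
        refine ⟨x, ?_⟩
        rw [Walk.length_cons, dist_comm, hw] at hq
        have h₁ : G.dist x a ≤ q.length := dist_le q
        have h₂ : G.dist a w ≤ G.dist a x + G.dist x w := hconn.dist_triangle
        have h₃ : G.dist x w = 1 := dist_eq_one_iff_adj.2 hadj.symm
        rw [dist_comm] at h₁
        simp only [Finset.mem_filter, Finset.mem_univ, true_and]
        exact ⟨hadj.symm, by omega⟩
    obtain ⟨u, hu, hmax⟩ := Finset.exists_max_image _ (fun x => c s(x, w)) hne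
    simp only [Finset.mem_filter, Finset.mem_univ, true_and] at hu hmax
    obtain ⟨p, hpd, hdist, hadj, hpmax⟩ := ih u hu.2
    refine ⟨Function.update p (d + 1) w, by simp, ?_, ?_, ?_⟩
    · intro i hi
      rcases Nat.lt_or_eq_of_le hi with hi | rfl
      · rw [Function.update_of_ne (by omega)]
        exact hdist i (by omega)
      · simpa using hw
    · intro i hi
      rw [Function.update_of_ne (by omega : i ≠ d + 1)]
      rcases Nat.lt_or_eq_of_le (Nat.le_of_lt_succ hi) with hi | rfl
      · rw [Function.update_of_ne (by omega)]
        exact hadj i hi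
      · simpa [hpd] using hu.1
    · intro i hi
      rw [Function.update_of_ne (by omega : i ≠ d + 1)]
      rcases Nat.lt_or_eq_of_le (Nat.le_of_lt_succ hi) with hi | rfl
      · rw [Function.update_of_ne (by omega)]
        exact hpmax i hi
      · intro x hx hxd
        simp only [Function.update_self] at hx ⊢
        rw [hpd]
        exact hmax x ⟨hx, hxd⟩

/-- The neighbors of `y` along edges whose color lies in `(lo, hi]`. -/
def colorNeighbors {V : Type*} [Fintype V] (G : SimpleGraph V) [DecidableRel G.Adj]
    (c : Sym2 V → ℕ) (y : V) (lo hi : ℕ) : Finset V :=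
  (G.neighborFinset y).filter fun x => lo < c s(y, x) ∧ c s(y, x) ≤ hi

lemma mem_colorNeighbors {V : Type*} [Fintype V] {G : SimpleGraph V} [DecidableRel G.Adj]
    {c : Sym2 V → ℕ} {y x : V} {lo hi : ℕ} :
    x ∈ colorNeighbors G c y lo hi ↔ G.Adj y x ∧ lo < c s(y, x) ∧ c s(y, x) ≤ hi := by
  simp [colorNeighbors]

lemma IsIntervalColoring.le_add_card_colorNeighbors {V : Type*} [Fintype V]
    {G : SimpleGraph V} [DecidableRel G.Adj] {t : ℕ} {c : Sym2 V → ℕ}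
    (hc : IsIntervalColoring G t c) {y u v : V} (hu : G.Adj y u) (hv : G.Adj y v) :
    c s(y, v) ≤ c s(y, u) + (colorNeighbors G c y (c s(y, u)) (c s(y, v))).card := by
  classical
  obtain ⟨lo, hi, hint⟩ := hc.2.2.2 y
  have hmem : ∀ x, G.Adj y x → c s(y, x) ∈ Set.Icc lo hi := fun x hx => by
    rw [← hint]
    exact ⟨s(y, x), hx, Sym2.mem_mk_left y x, rfl⟩
  have hsub : Finset.Ioc (c s(y, u)) (c s(y, v)) ⊆
      (colorNeighbors G c y (c s(y, u)) (c s(y, v))).image fun x => c s(y, x) := by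
    intro i hi
    rw [Finset.mem_Ioc] at hi
    have hicc : i ∈ Set.Icc lo _ := ⟨(hmem u hu).1.trans hi.1.le, hi.2.trans (hmem v hv).2⟩
    rw [← hint] at hicc
    obtain ⟨e, he, hye, rfl⟩ := hicc
    obtain ⟨x, rfl⟩ := hye
    exact Finset.mem_image.2 ⟨x, mem_colorNeighbors.2 ⟨he, hi⟩, rfl⟩
  have := (Finset.card_le_card hsub).trans Finset.card_image_le
  rw [Nat.card_Ioc] at this
  omega

lemma card_colorNeighbors_lt_degree {V : Type*} [Fintype V] {G : SimpleGraph V}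
    [DecidableRel G.Adj] {c : Sym2 V → ℕ} {y u : V} (hu : G.Adj y u) (hi : ℕ) :
    (colorNeighbors G c y (c s(y, u)) hi).card < G.degree y := by
  rw [← G.card_neighborFinset_eq_degree]
  refine Finset.card_lt_card (Finset.ssubset_iff_subset_ne.2 ⟨Finset.filter_subset _ _, ?_⟩)
  intro heq
  have : u ∈ colorNeighbors G c y (c s(y, u)) hi := by
    rw [heq]
    simpa using hu
  exact lt_irrefl _ (mem_colorNeighbors.1 this).2.1

open SimpleGraph in
lemma IsIntervalColoring.exists_closest_edge {V : Type*} [Fintype V] {G : SimpleGraph V}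
    {t : ℕ} {c : Sym2 V → ℕ} (hc : IsIntervalColoring G t c) (ht : 1 ≤ t) (w : V) :
    ∃ a b, G.Adj a b ∧ c s(a, b) = 1 ∧ G.dist a w ≤ G.dist b w := by
  obtain ⟨e, he, hce⟩ := hc.2.1 1 (by simp [ht])
  induction e with
  | h a b =>
    rcases le_total (G.dist a w) (G.dist b w) with h | h
    · exact ⟨a, b, he, hce, h⟩
    · exact ⟨b, a, he.symm, by rwa [Sym2.eq_swap], h⟩

/-- If `G` is a connected `r`-regular graph with `|V(G)| ≥ 2r + 2` admitting an
interval `t`-coloring for some `t ≥ 1`, then `t ≤ 2|V(G)| - 5`; hence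
`W(G) ≤ 2|V(G)| - 5`. -/
theorem interval_coloring_regular_bound {V : Type*} [Fintype V] [DecidableEq V]
    (G : SimpleGraph V) [DecidableRel G.Adj] (r : ℕ) (hconn : G.Connected)
    (hreg : G.IsRegularOfDegree r) (hcard : Fintype.card V ≥ 2 * r + 2)
    (t : ℕ) (ht : 1 ≤ t) (h : HasIntervalColoring G t) :
    t ≤ 2 * Fintype.card V - 5 := by
  obtain ⟨c, hc⟩ := h
  obtain ⟨e, he, hce⟩ := hc.2.1 t (by simp [ht])
  obtain ⟨w, z⟩ := e
  replace he : G.Adj w z := he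
  replace hce : c s(w, z) = t := hce
  obtain ⟨a, b, hab, hcab, hclose⟩ := hc.exists_closest_edge ht w
  obtain ⟨d, hd⟩ : ∃ d, G.dist a w = d := ⟨_, rfl⟩
  obtain ⟨p, hpd, hdist, hadj, hmax⟩ := exists_color_maximal_geodesic hconn c a d w hd
  have hp0 : p 0 = a := ((hconn a (p 0)).dist_eq_zero_iff.1 (hdist 0 (by omega))).symm
  have hdistw : ∀ k ≤ d, G.dist (p (d - k)) w ≤ k := by
    intro k
    induction k with
    | zero => simp [hpd]
    | succ k ih =>
      intro hk
      have hstep := hadj (d - (k + 1)) (by omega)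
      rw [show d - (k + 1) + 1 = d - k by omega] at hstep
      have h₁ := SimpleGraph.dist_eq_one_iff_adj.2 hstep
      have h₂ : G.dist (p (d - (k + 1))) w ≤ _ + G.dist (p (d - k)) w := hconn.dist_triangle
      have := ih (by omega)
      omega
  have hdist_adj : ∀ x y, G.Adj x y → G.dist a y ≤ G.dist a x + 1 := by
    intro x y hxy
    rw [← SimpleGraph.dist_eq_one_iff_adj.2 hxy]
    exact hconn.dist_triangle
  let L : ℕ → ℕ := fun j => if j = 0 then 1 else if j ≤ d then c s(p (j - 1), p j) else t
  have hL0 : L 0 = 1 := rfl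
  have hLd : L (d + 1) = t := by simp [L]
  have hLs : ∀ j < d, L (j + 1) = c s(p j, p (j + 1)) := by
    intro j hj
    simp [L, Nat.succ_le_of_lt hj]
  have hlow : ∀ j ≤ d, ∃ u, G.Adj (p j) u ∧ c s(p j, u) = L j := by
    intro j hj
    cases j with
    | zero => exact ⟨b, by rwa [hp0], by rw [hp0, hL0, hcab]⟩
    | succ j => exact ⟨p j, (hadj j hj).symm, by rw [hLs j hj, Sym2.eq_swap]⟩
  have hhigh : ∀ j ≤ d, ∃ u, G.Adj (p j) u ∧ c s(p j, u) = L (j + 1) := by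
    intro j hj
    rcases Nat.lt_or_eq_of_le hj with hj | rfl
    · exact ⟨p (j + 1), hadj j hj, (hLs j hj).symm⟩
    · exact ⟨z, by rwa [hpd], by rw [hpd, hLd, hce]⟩
  let A : ℕ → Finset V := fun j => colorNeighbors G c (p j) (L j) (L (j + 1))
  have hstep : ∀ j ≤ d, L (j + 1) ≤ L j + (A j).card := by
    intro j hj
    obtain ⟨u, hu, hcu⟩ := hlow j hj
    obtain ⟨v, hv, hcv⟩ := hhigh j hj
    simpa only [hcu, hcv] using hc.le_add_card_colorNeighbors hu hv
  have hsum : t ≤ 1 + ∑ j ∈ Finset.range (d + 1), (A j).card := by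
    have : ∀ k ≤ d + 1, L k ≤ 1 + ∑ j ∈ Finset.range k, (A j).card := by
      intro k
      induction k with
      | zero => simp [hL0]
      | succ k ih =>
        intro hk
        rw [Finset.sum_range_succ]
        have := ih (by omega)
        have := hstep k (by omega)
        omega
    simpa [hLd] using this (d + 1) le_rfl
  rcases Nat.lt_or_ge d 4 with hd4 | hd4
  · have hA : ∀ j ∈ Finset.range (d + 1), (A j).card ≤ r - 1 := by
      intro j hj
      obtain ⟨u, hu, hcu⟩ := hlow j (by simpa [Nat.lt_succ_iff] using hj)
      have := card_colorNeighbors_lt_degree (c := c) hu (L (j + 1))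
      rw [hcu, hreg] at this
      exact Nat.le_sub_one_of_lt this
    have h₁ := Finset.sum_le_card_nsmul _ _ _ hA
    rw [Finset.card_range, smul_eq_mul] at h₁
    have h₂ : (d + 1) * (r - 1) ≤ 4 * (r - 1) := Nat.mul_le_mul_right _ hd4
    have hr : 0 < r := by
      rw [← hreg a, SimpleGraph.degree_pos_iff_exists_adj]
      exact ⟨b, hab⟩
    omega
  · let B : ℕ → Finset V := fun j => insert (p j) (A j)
    have hpA : ∀ i ≤ d, ∀ j ≤ d, i % 2 = j % 2 → p i ∉ A j := by
      intro i hi j hj hij hmem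
      have hadj' : G.Adj (p j) (p i) := (mem_colorNeighbors.1 hmem).1
      have h₁ := hdist_adj _ _ hadj'
      have h₂ := hdist_adj _ _ hadj'.symm
      rw [hdist i hi, hdist j hj] at h₁ h₂
      obtain rfl : i = j := by omega
      exact G.loopless.irrefl _ hadj'
    have hAA : ∀ i j, i < j → j ≤ d → i % 2 = j % 2 → ∀ x ∈ A i, x ∉ A j := by
      intro i j hlt hj hij x hxi hxj
      obtain ⟨hix, -, -⟩ := mem_colorNeighbors.1 hxi
      obtain ⟨hjx, hlo, -⟩ := mem_colorNeighbors.1 hxj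
      have h₁ := hdist_adj _ _ hix
      have h₂ := hdist_adj _ _ hjx.symm
      rw [hdist i (by omega)] at h₁
      rw [hdist j hj] at h₂
      obtain rfl : j = i + 1 + 1 := by omega
      have := hmax (i + 1) (by omega) x hjx.symm (by omega)
      rw [hLs (i + 1) (by omega), Sym2.eq_swap (a := p (i + 1 + 1))] at hlo
      omega
    have hBB : ∀ i j, i < j → j ≤ d → i % 2 = j % 2 → Disjoint (B i) (B j) := by
      intro i j hlt hj hij
      rw [Finset.disjoint_left]
      intro x hxi hxj
      rcases Finset.mem_insert.1 hxi with rfl | hxi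
      · rcases Finset.mem_insert.1 hxj with heq | hxj
        · have := hdist i (by omega)
          rw [heq, hdist j hj] at this
          omega
        · exact hpA i (by omega) j hj hij hxj
      · rcases Finset.mem_insert.1 hxj with rfl | hxj
        · exact hpA j hj i (by omega) hij.symm hxi
        · exact hAA i j hlt hj hij x hxi hxj
    have hbB : ∀ j ≤ d, j % 2 = 0 → b ∉ B j := by
      intro j hj hj2 hmem
      rcases Finset.mem_insert.1 hmem with heq | hmem
      · have h₁ := SimpleGraph.dist_eq_one_iff_adj.2 hab
        rw [heq, hdist j hj] at h₁
        omega
      · obtain ⟨hjb, hlo, -⟩ := mem_colorNeighbors.1 hmem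
        rcases Nat.eq_zero_or_pos j with rfl | hpos
        · rw [hp0, hcab, hL0] at hlo
          omega
        · have h₁ := hdistw (d - j) (by omega)
          rw [show d - (d - j) = j by omega] at h₁
          have h₂ := SimpleGraph.dist_eq_one_iff_adj.2 hjb.symm
          have h₃ : G.dist b w ≤ G.dist b (p j) + _ := hconn.dist_triangle
          omega
    have hcardB : ∀ j ≤ d, (B j).card = (A j).card + 1 := fun j hj =>
      Finset.card_insert_of_notMem (hpA j hj j hj rfl)
    have hclass : ∀ m, ∑ j ∈ (Finset.range (d + 1)).filter (fun j => j % 2 = m), (B j).card =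
        (((Finset.range (d + 1)).filter fun j => j % 2 = m).biUnion B).card := by
      intro m
      rw [Finset.card_biUnion]
      intro i hi j hj hne
      simp only [Finset.mem_coe, Finset.mem_filter, Finset.mem_range] at hi hj
      rcases Nat.lt_or_gt_of_ne hne with hlt | hlt
      · exact hBB i j hlt (by omega) (by omega)
      · exact (hBB j i hlt (by omega) (by omega)).symm
    have heven : (((Finset.range (d + 1)).filter fun j => j % 2 = 0).biUnion B).card <
        Fintype.card V := by
      refine Finset.card_lt_univ_of_notMem (x := b) ?_
      simp only [Finset.mem_biUnion, Finset.mem_filter, Finset.mem_range, not_exists, not_and]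
      exact fun j hj => hbB j (by omega) hj.2
    have hodd := Finset.card_le_univ (((Finset.range (d + 1)).filter fun j => j % 2 = 1).biUnion B)
    rw [← hclass] at heven hodd
    have hsplit := Finset.sum_filter_add_sum_filter_not (Finset.range (d + 1))
      (fun j => j % 2 = 0) fun j => (B j).card
    simp only [Nat.mod_two_ne_zero] at hsplit
    have htotal : ∑ j ∈ Finset.range (d + 1), (B j).card =
        ∑ j ∈ Finset.range (d + 1), (A j).card + (d + 1) := by
      rw [Finset.sum_congr rfl fun j hj => hcardB j (by simpa [Nat.lt_succ_iff] using hj),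
        Finset.sum_add_distrib]
      simp
    omega
end
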